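/- Let n ≥ 2, p < 1, and 0 < τ1 < τ2. Suppose f : S^{n-1} → ℝ satisfies τ1 < f(u) < τ2 for all u ∈ S^{n-1}, and K ∈ K_0^n is a solution of the L_p Minkowski problem dS_{K,p} = f dH^{n-1}. If n = 2, or n = 3, or (n > 3 and p < 4 − n), then K is smooth. -/

import Mathlib

open MeasureTheory Set
open scoped ENNReal NNReal RealInnerProductSpace

noncomputable section

/-- Support function of a set `K`. -/
def suppFn {n : ℕ} (K : Set (EuclideanSpace ℝ (Fin n))) (u : EuclideanSpace ℝ (Fin n)) : ℝ :=
  sSup ((fun y => ⟪u, y⟫) '' K)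

/-- Face of `K` with outer normal `u`. -/
def face {n : ℕ} (K : Set (EuclideanSpace ℝ (Fin n))) (u : EuclideanSpace ℝ (Fin n)) :
    Set (EuclideanSpace ℝ (Fin n)) :=
  {z ∈ K | ⟪z, u⟫ = suppFn K u}

/-- Normal cone of `K` at `z`. -/
def normalCone {n : ℕ} (K : Set (EuclideanSpace ℝ (Fin n))) (z : EuclideanSpace ℝ (Fin n)) :
    Set (EuclideanSpace ℝ (Fin n)) :=
  {u | ∀ y ∈ K, ⟪u, y⟫ ≤ ⟪u, z⟫}

/-- The unit sphere `S^{n-1}` in `ℝ^n`. -/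
def unitSphere (n : ℕ) : Set (EuclideanSpace ℝ (Fin n)) :=
  Metric.sphere (0 : EuclideanSpace ℝ (Fin n)) 1

/-- Surface area measure of `K` evaluated on `ω`:
`S_K(ω) = H^{n-1}(⋃_{u ∈ ω} F(K,u))`. -/
def surfMeas {n : ℕ} (K : Set (EuclideanSpace ℝ (Fin n)))
    (ω : Set (EuclideanSpace ℝ (Fin n))) : ℝ≥0∞ :=
  μH[(n : ℝ) - 1] (⋃ u ∈ ω, face K u)

/-- `K ∈ 𝒦₀ⁿ`: compact convex with nonempty interior, containing the origin. -/
def IsConvexBody0 {n : ℕ} (K : Set (EuclideanSpace ℝ (Fin n))) : Prop :=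
  IsCompact K ∧ Convex ℝ K ∧ (interior K).Nonempty ∧ (0 : EuclideanSpace ℝ (Fin n)) ∈ K

/-- `K` is a solution of the `L_p` Minkowski problem `dS_{K,p} = f dH^{n-1}`. -/
def IsLpSolution {n : ℕ} (p : ℝ) (f : EuclideanSpace ℝ (Fin n) → ℝ)
    (K : Set (EuclideanSpace ℝ (Fin n))) : Prop :=
  μH[(n : ℝ) - 1] {u ∈ unitSphere n | suppFn K u = 0} = 0 ∧
  ∀ ω : Set (EuclideanSpace ℝ (Fin n)), MeasurableSet ω →
    ω ⊆ {u ∈ unitSphere n | 0 < suppFn K u} →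
    surfMeas K ω
      = ∫⁻ u in ω, ENNReal.ofReal ((n : ℝ) * f u * suppFn K u ^ (p - 1)) ∂μH[(n : ℝ) - 1]

/-- `x` is a smooth boundary point: the normal cone spans a one-dimensional space. -/
def IsSmoothPt {n : ℕ} (K : Set (EuclideanSpace ℝ (Fin n)))
    (x : EuclideanSpace ℝ (Fin n)) : Prop :=
  Module.finrank ℝ (Submodule.span ℝ (normalCone K x)) = 1

/-- `K` is smooth: every boundary point is a smooth point. -/
def IsSmoothBody {n : ℕ} (K : Set (EuclideanSpace ℝ (Fin n))) : Prop :=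
  ∀ x ∈ frontier K, IsSmoothPt K x

/-- Subgradient of `v` at `x` relative to the domain `Ω`. -/
def subgrad {n : ℕ} (Ω : Set (EuclideanSpace ℝ (Fin n))) (v : EuclideanSpace ℝ (Fin n) → ℝ)
    (x : EuclideanSpace ℝ (Fin n)) : Set (EuclideanSpace ℝ (Fin n)) :=
  {z | ∀ y ∈ Ω, v x + ⟪z, y - x⟫ ≤ v y}

/-- Monge–Ampère measure of `v` (relative to domain `Ω`) evaluated on `ω`. -/
def maMeasure {n : ℕ} (Ω : Set (EuclideanSpace ℝ (Fin n))) (v : EuclideanSpace ℝ (Fin n) → ℝ)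
    (ω : Set (EuclideanSpace ℝ (Fin n))) : ℝ≥0∞ :=
  μH[(n : ℝ)] (⋃ x ∈ ω, subgrad Ω v x)

/-- Hessian matrix of `v : ℝ^n → ℝ` at `x`. -/
def hessMatrix {n : ℕ} (v : EuclideanSpace ℝ (Fin n) → ℝ) (x : EuclideanSpace ℝ (Fin n)) :
    Matrix (Fin n) (Fin n) ℝ :=
  Matrix.of fun i j =>
    fderiv ℝ (fun y => fderiv ℝ v y (EuclideanSpace.single j 1)) x (EuclideanSpace.single i 1)



/-- global subdifferential -/
def sdf {m : ℕ} (v : (Fin m → ℝ) → ℝ) (y : Fin m → ℝ) : Set (Fin m → ℝ) :=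
  {q | ∀ y', v y + q ⬝ᵥ (y' - y) ≤ v y'}

/-- image of a set under the subdifferential -/
def sdI {m : ℕ} (v : (Fin m → ℝ) → ℝ) (ω : Set (Fin m → ℝ)) : Set (Fin m → ℝ) :=
  ⋃ y ∈ ω, sdf v y

lemma sdI_shift {m : ℕ} (v : (Fin m → ℝ) → ℝ) (l : Fin m → ℝ) (k : ℝ) (ω : Set (Fin m → ℝ)) :
    volume (sdI (fun y => v y - (l ⬝ᵥ y + k)) ω) = volume (sdI v ω) := by
  have : sdI (fun y => v y - (l ⬝ᵥ y + k)) ω = (fun q => q + l) ⁻¹' (sdI v ω) := by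
    ext q
    simp only [sdI, sdf, mem_iUnion, mem_ofPred_eq, mem_preimage, exists_prop]
    refine exists_congr fun y => and_congr_right fun _ => forall_congr' fun y' => ?_
    rw [add_dotProduct, dotProduct_sub l]
    constructor <;> intro h <;> linarith
  rw [this, measure_preimage_add_right]

lemma norm_matrix {m : ℕ} (Z : Set (Fin m → ℝ)) (hZ : IsCompact Z) (h0 : Z ∈ nhds 0) :
    ∃ A : Matrix (Fin m) (Fin m) ℝ, A.det ≠ 0 ∧ (∀ i, A.transpose i ∈ Z) ∧
      ∀ z ∈ Z, ∃ t : Fin m → ℝ, A.mulVec t = z ∧ ∀ i, |t i| ≤ 1 := by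
  have hcomp : IsCompact (Set.pi univ (fun _ : Fin m => Z)) := isCompact_univ_pi (fun _ => hZ)
  have hz0 : (0 : Fin m → ℝ) ∈ Z := mem_of_mem_nhds h0
  obtain ⟨e, he, hmax⟩ := hcomp.exists_isMaxOn ⟨fun _ => 0, fun _ _ => hz0⟩
    (f := fun e => |(Matrix.of e).det|) (by
      apply Continuous.continuousOn
      apply Continuous.abs
      exact Continuous.matrix_det (by fun_prop))
  have hpos : 0 < |(Matrix.of e).det| := by
    obtain ⟨r, hr, hb⟩ := Metric.mem_nhds_iff.1 h0
    have h1 : (fun i : Fin m => (r/2) • (Pi.single i 1 : Fin m → ℝ)) ∈ Set.pi univ (fun _ : Fin m => Z) := by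
      intro i _
      apply hb
      rw [mem_ball_zero_iff, norm_smul, Pi.norm_single]
      simp only [Real.norm_eq_abs, abs_one, mul_one]
      rw [abs_of_pos (by linarith)]; linarith
    refine lt_of_lt_of_le ?_ (hmax h1)
    have : Matrix.of (fun i : Fin m => (r/2) • (Pi.single i 1 : Fin m → ℝ)) = (r/2) • (1 : Matrix (Fin m) (Fin m) ℝ) := by
      ext i j
      simp [Matrix.one_apply, Pi.single_apply, eq_comm]
    simp only [this]
    rw [Matrix.det_smul, Matrix.det_one, mul_one]
    positivity
  set A := (Matrix.of e).transpose with hA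
  have hdet : |A.det| = |(Matrix.of e).det| := by rw [hA, Matrix.det_transpose]
  have hdet0 : A.det ≠ 0 := by
    intro h; rw [h, abs_zero] at hdet; linarith
  refine ⟨A, hdet0, fun i => he i (mem_univ i), fun z hz => ?_⟩
  refine ⟨A.det⁻¹ • A.cramer z, ?_, fun i => ?_⟩
  · rw [Matrix.mulVec_smul, Matrix.mulVec_cramer, smul_smul, inv_mul_cancel₀ hdet0, one_smul]
  · rw [Pi.smul_apply, smul_eq_mul, abs_mul, abs_inv, inv_mul_le_iff₀ (by rw [hdet]; exact hpos), mul_one,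
      Matrix.cramer_apply, hdet]
    have h2 : A.updateCol i z = (Matrix.of (Function.update e i z)).transpose := by
      ext a c
      by_cases h : c = i
      · subst h; simp
      · simp [h, hA]
    rw [h2, Matrix.det_transpose]
    refine hmax (a := Function.update e i z) ?_
    intro j _
    by_cases h : j = i
    · subst h; simpa using hz
    · simpa [h] using he j (mem_univ j)

lemma mulVec_mem {m : ℕ} (hm : 0 < m) {Z : Set (Fin m → ℝ)} (hZ : Convex ℝ Z) (h0 : 0 ∈ Z)
    (A : Matrix (Fin m) (Fin m) ℝ) (hA : ∀ i, A.transpose i ∈ Z) (t : Fin m → ℝ)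
    (ht : ∀ i, 0 ≤ t i ∧ t i ≤ 1 / m) : A.mulVec t ∈ Z := by
  have hm' : (0:ℝ) < m := by exact_mod_cast hm
  have h1 : A.mulVec t = ∑ i, (1 / (m:ℝ)) • (((m:ℝ) * t i) • A.transpose i) := by
    ext k
    simp only [Matrix.mulVec, dotProduct, Finset.sum_apply, Pi.smul_apply, Matrix.transpose_apply, smul_eq_mul]
    refine Finset.sum_congr rfl fun i _ => ?_
    field_simp
  rw [h1]
  refine hZ.sum_mem (fun i _ => by positivity) ?_ (fun i _ => ?_)
  · simp; field_simp
  · refine hZ.smul_mem_of_zero_mem h0 (hA i) ⟨mul_nonneg hm'.le (ht i).1, ?_⟩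
    have := (ht i).2
    rw [le_div_iff₀ hm'] at this; linarith

lemma alex_low {m : ℕ} (hm : 0 < m) {w : (Fin m → ℝ) → ℝ} {Z : Set (Fin m → ℝ)} (hZ : Convex ℝ Z)
    (h0 : 0 ∈ Z) (hw : ∀ z ∈ Z, w z ≤ 0) {M : ℝ} (hM : ∀ z ∈ Z, -M ≤ w z)
    (A : Matrix (Fin m) (Fin m) ℝ) (hA : ∀ i, A.transpose i ∈ Z) :
    ENNReal.ofReal |A.det| * volume (sdI w ((Matrix.toLin' A) '' (Icc (fun _ => 1 / (4 * (m:ℝ))) (fun _ => 3 / (4 * (m:ℝ))))))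
      ≤ ENNReal.ofReal ((8 * m * M) ^ m) := by
  have hm' : (0:ℝ) < m := by exact_mod_cast hm
  have hM0 : 0 ≤ M := by have := hM 0 h0; have := hw 0 h0; linarith
  have key : (Matrix.toLin' A.transpose) '' (sdI w ((Matrix.toLin' A) '' (Icc (fun _ => 1 / (4 * (m:ℝ))) (fun _ => 3 / (4 * (m:ℝ))))))
     ⊆ Icc (fun _ => - (4 * m * M)) (fun _ => 4 * m * M) := by
    rintro _ ⟨q, hq, rfl⟩
    simp only [sdI, mem_iUnion, exists_prop] at hq
    obtain ⟨_, ⟨t, ht, rfl⟩, hq⟩ := hq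
    have e4 : 1 / (4 * (m:ℝ)) * 4 = 1 / m := by field_simp
    have e43 : 3 / (4 * (m:ℝ)) = 3 * (1 / (4 * (m:ℝ))) := by ring
    have p4 : 0 < 1 / (4 * (m:ℝ)) := by positivity
    have ht1 : ∀ i, 1 / (4 * (m:ℝ)) ≤ t i := fun i => ht.1 i
    have ht2 : ∀ i, t i ≤ 3 / (4 * (m:ℝ)) := fun i => ht.2 i
    rw [Matrix.toLin'_apply] at hq ⊢
    have htZ : A.mulVec t ∈ Z := mulVec_mem hm hZ h0 A hA t (fun i => by
      have := ht1 i; have := ht2 i; constructor <;> linarith)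
    have main : ∀ (s : ℝ), |s| ≤ 1 → ∀ i, s * (A.transpose.mulVec q) i ≤ 4 * m * M := by
      intro s hs i
      have hs' := abs_le.1 hs
      have hZ' : A.mulVec (t + Pi.single i (s / (4 * m))) ∈ Z := by
        apply mulVec_mem hm hZ h0 A hA
        intro j
        have h1 := ht1 j; have h2 := ht2 j
        by_cases hj : j = i
        · subst hj
          simp only [Pi.add_apply, Pi.single_eq_same]
          have : s / (4 * m) = s * (1 / (4 * (m:ℝ))) := by ring
          rw [this]
          constructor <;> nlinarith
        · simp only [Pi.add_apply, Pi.single_eq_of_ne hj, add_zero]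
          constructor <;> linarith
      have h3 := hq (A.mulVec (t + Pi.single i (s / (4 * m))))
      have h4 := hw _ hZ'
      have h5 := hM _ htZ
      have h6 : q ⬝ᵥ (A.mulVec (t + Pi.single i (s / (4 * m))) - A.mulVec t) = s / (4 * m) * (A.transpose.mulVec q) i := by
        rw [Matrix.mulVec_add, add_sub_cancel_left, Matrix.dotProduct_mulVec, dotProduct_single, Matrix.mulVec_transpose]
        ring
      rw [h6] at h3
      have h7 : s / (4 * m) * (A.transpose.mulVec q) i ≤ M := by linarith
      have : s * (A.transpose.mulVec q) i = 4 * m * (s / (4 * m) * (A.transpose.mulVec q) i) := by field_simp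
      rw [this]; gcongr
    constructor
    · intro i
      have := main (-1) (by simp) i
      simp only
      linarith
    · intro i
      have := main 1 (by simp) i
      simpa using this
  have := measure_mono (μ := volume) key
  rw [Measure.addHaar_image_linearMap, LinearMap.det_toLin', Matrix.det_transpose, Real.volume_Icc_pi] at this
  refine this.trans (le_of_eq ?_)
  simp only [Finset.prod_const, Finset.card_univ, Fintype.card_fin]
  have e : 4 * m * M - -(4 * m * M) = 8 * m * M := by ring
  rw [e, ← ENNReal.ofReal_pow (by positivity)]

lemma alex_up {m : ℕ} {w : (Fin m → ℝ) → ℝ} (hw : ConvexOn ℝ univ w) (hc : Continuous w)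
    {Z : Set (Fin m → ℝ)} (hZ : Z = {z | w z ≤ 0}) (hcomp : IsCompact Z) {m0 : ℝ} (hm0 : 0 < m0)
    (h0 : w 0 = - m0) : {q | ∀ z ∈ Z, q ⬝ᵥ z ≤ m0} ⊆ sdI w Z := by
  intro q hq
  have h0Z : (0 : Fin m → ℝ) ∈ Z := by rw [hZ]; simp [h0, hm0.le]
  have hcg : Continuous (fun z => w z - q ⬝ᵥ z) := by
    refine hc.sub ?_
    unfold dotProduct; fun_prop
  have hconv : ConvexOn ℝ univ (fun z => w z - q ⬝ᵥ z) := by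
    refine ⟨convex_univ, fun a _ b _ s t hs ht hst => ?_⟩
    have := hw.2 (mem_univ a) (mem_univ b) hs ht hst
    simp only [dotProduct_add, dotProduct_smul, smul_eq_mul] at *
    linarith
  have fin : ∀ y, w y < 0 → (∀ z ∈ Z, w y - q ⬝ᵥ y ≤ w z - q ⬝ᵥ z) → q ∈ sdI w Z := by
    intro y hy hmin
    have hloc : IsLocalMin (fun z => w z - q ⬝ᵥ z) y := by
      have : {z | w z < 0} ∈ nhds y := (isOpen_lt hc continuous_const).mem_nhds hy
      filter_upwards [this] with z hz
      exact hmin z (by rw [hZ]; exact le_of_lt hz)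
    have hg := IsMinOn.of_isLocalMin_of_convex_univ hloc hconv
    simp only [sdI, mem_iUnion, exists_prop]
    refine ⟨y, by rw [hZ]; exact hy.le, fun y' => ?_⟩
    have := hg y'
    rw [dotProduct_sub]; linarith
  obtain ⟨y, hy, hmin⟩ := hcomp.exists_isMinOn ⟨0, h0Z⟩ hcg.continuousOn
  have hmin' : ∀ z ∈ Z, w y - q ⬝ᵥ y ≤ w z - q ⬝ᵥ z := fun z hz => hmin hz
  rcases lt_or_ge (w y) 0 with h | h
  · exact fin y h hmin'
  · refine fin 0 (by linarith) fun z hz => ?_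
    have h1 := hq y hy
    have h2 := hmin' z hz
    rw [dotProduct_zero, h0]; linarith

lemma updateCol_mulVec_aux {m : ℕ} (j : Fin m) (s x : Fin m → ℝ) :
    ((1 : Matrix (Fin m) (Fin m) ℝ).updateCol j s).mulVec x = x j • s + Function.update x j 0 := by
  ext i
  simp only [Matrix.mulVec, dotProduct, Pi.add_apply, Pi.smul_apply, smul_eq_mul]
  rw [← Finset.add_sum_erase _ _ (Finset.mem_univ j)]
  simp only [Matrix.updateCol_self]
  have : ∑ k ∈ Finset.univ.erase j, (1 : Matrix (Fin m) (Fin m) ℝ).updateCol j s i k * x k = Function.update x j 0 i := by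
    have h1 : ∀ k ∈ Finset.univ.erase j, (1 : Matrix (Fin m) (Fin m) ℝ).updateCol j s i k * x k
        = if i = k then x k else 0 := by
      intro k hk
      rw [Matrix.updateCol_ne (Finset.ne_of_mem_erase hk), Matrix.one_apply]
      split_ifs <;> simp
    rw [Finset.sum_congr rfl h1, Finset.sum_ite_eq]
    by_cases h : i = j
    · subst h; simp
    · simp [h]
  rw [this]; ring

lemma polar_vol {m : ℕ} {Z : Set (Fin m → ℝ)} (A : Matrix (Fin m) (Fin m) ℝ) (hA : A.det ≠ 0)
    (hZ : ∀ z ∈ Z, ∃ t : Fin m → ℝ, A.mulVec t = z ∧ ∀ i, |t i| ≤ 1) (l : Fin m → ℝ) {η m0 : ℝ}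
    (hη : 0 < η) (hm0 : 0 < m0) (hl : ∀ z ∈ Z, l ⬝ᵥ z ≤ η) (j : Fin m) :
    ENNReal.ofReal (|(A.transpose.mulVec l) j| * (m0 / η) * (1 / 2) * (m0 / m) ^ (m - 1)) ≤
      ENNReal.ofReal |A.det| * volume {q | ∀ z ∈ Z, q ⬝ᵥ z ≤ m0} := by
  have hm : 0 < m := j.pos
  have hm' : (0:ℝ) < m := by exact_mod_cast hm
  set s : Fin m → ℝ := (m0 / η) • A.transpose.mulVec l with hs
  set lo : Fin m → ℝ := fun k => if k = j then 0 else -(m0 / (2 * m)) with hlo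
  set hi : Fin m → ℝ := fun k => if k = j then 1 / 2 else m0 / (2 * m) with hhi
  have hsub : Matrix.toLin' ((1 : Matrix (Fin m) (Fin m) ℝ).updateCol j s) '' Icc lo hi ⊆
      Matrix.toLin' A.transpose '' {q | ∀ z ∈ Z, q ⬝ᵥ z ≤ m0} := by
    rintro _ ⟨x, hx, rfl⟩
    have hdu : IsUnit A.transpose.det := by rw [Matrix.det_transpose]; exact isUnit_iff_ne_zero.2 hA
    rw [Matrix.toLin'_apply, updateCol_mulVec_aux]
    set σ := x j • s + Function.update x j 0 with hσ
    refine ⟨(A.transpose)⁻¹.mulVec σ, ?_, ?_⟩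
    · intro z hz
      obtain ⟨t, rfl, ht⟩ := hZ z hz
      have h1 : ∀ q, q ⬝ᵥ A.mulVec t = A.transpose.mulVec q ⬝ᵥ t := by
        intro q
        rw [Matrix.dotProduct_mulVec, Matrix.mulVec_transpose]
      have h2 := hl _ hz
      rw [h1] at h2 ⊢
      rw [Matrix.mulVec_mulVec, Matrix.mul_nonsing_inv _ hdu, Matrix.one_mulVec, hσ, add_dotProduct,
        smul_dotProduct, hs, smul_dotProduct, smul_eq_mul, smul_eq_mul]
      have hxj0 : 0 ≤ x j := by simpa [hlo] using hx.1 j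
      have hxj1 : x j ≤ 1 / 2 := by simpa [hhi] using hx.2 j
      have h3 : m0 / η * (A.transpose.mulVec l ⬝ᵥ t) ≤ m0 := by
        calc m0 / η * (A.transpose.mulVec l ⬝ᵥ t) ≤ m0 / η * η := by gcongr
          _ = m0 := by field_simp
      have h4 : Function.update x j 0 ⬝ᵥ t ≤ m0 / 2 := by
        calc Function.update x j 0 ⬝ᵥ t ≤ ∑ k : Fin m, m0 / (2 * m) := by
              unfold dotProduct
              refine Finset.sum_le_sum fun k _ => ?_
              by_cases hk : k = j
              · subst hk; simp; positivity
              · have a1 := hx.1 k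
                have a2 := hx.2 k
                simp only [hlo, hhi, hk, if_false] at a1 a2
                rw [Function.update_of_ne hk]
                calc x k * t k ≤ |x k| * |t k| := by rw [← abs_mul]; exact le_abs_self _
                  _ ≤ m0 / (2 * m) * 1 := by
                      gcongr
                      · exact abs_le.2 ⟨a1, a2⟩
                      · exact ht k
                  _ = _ := mul_one _
          _ = m0 / 2 := by simp; field_simp
      nlinarith
    · rw [Matrix.toLin'_apply, Matrix.mulVec_mulVec, Matrix.mul_nonsing_inv _ hdu, Matrix.one_mulVec]
  have := measure_mono (μ := volume) hsub
  rw [Measure.addHaar_image_linearMap, Measure.addHaar_image_linearMap, LinearMap.det_toLin',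
    LinearMap.det_toLin', Matrix.det_transpose, ← Matrix.cramer_apply, Matrix.cramer_one, Real.volume_Icc_pi] at this
  refine le_trans (le_of_eq ?_) this
  have h5 : ∏ i, ENNReal.ofReal (hi i - lo i) = ENNReal.ofReal ((1 / 2) * (m0 / m) ^ (m - 1)) := by
    rw [← ENNReal.ofReal_prod_of_nonneg]
    · congr 1
      rw [← Finset.mul_prod_erase _ _ (Finset.mem_univ j)]
      have : ∏ k ∈ Finset.univ.erase j, (hi k - lo k) = ∏ k ∈ Finset.univ.erase j, (m0 / m) := by
        refine Finset.prod_congr rfl fun k hk => ?_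
        simp only [hlo, hhi, Finset.ne_of_mem_erase hk, if_false]
        field_simp; ring
      rw [this]
      simp [hlo, hhi, div_pow]
    · intro k _
      simp only [hlo, hhi]
      split_ifs
      · norm_num
      · have : 0 < m0 / (2 * m) := by positivity
        linarith
  rw [h5, ← ENNReal.ofReal_mul (abs_nonneg _)]
  congr 1
  simp only [Module.End.one_apply, hs, Pi.smul_apply, smul_eq_mul, abs_mul]
  rw [abs_of_pos (div_pos hm0 hη)]
  ring

lemma core_arith {m : ℕ} (hm : 0 < m) {c1 c2 δ η m0 M D a : ℝ} (hc1 : 0 < c1) (hc2 : 0 < c2)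
    (hη : 0 < η) (hm0 : 0 < m0) (hM0 : 0 ≤ M) (hM : M ≤ 2 * m0) (ha : δ / m ≤ a)
    (h1 : D * (c1 * (D * (1 / (2 * m)) ^ m)) ≤ (8 * m * M) ^ m)
    (h2 : a * (m0 / η) * (1 / 2) * (m0 / m) ^ (m - 1) ≤ D * (c2 * (D * 2 ^ m))) :
    δ / η ≤ 2 * m ^ m * (c2 / c1) * (64 * m ^ 2) ^ m := by
  have hm' : (0:ℝ) < m := by exact_mod_cast hm
  have e1 : D * D * c1 ≤ (32 * m ^ 2 * m0) ^ m := by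
    have : D * D * c1 = D * (c1 * (D * (1 / (2 * m)) ^ m)) * (2 * m) ^ m := by
      rw [one_div, inv_pow]; field_simp
    rw [this]
    calc _ ≤ (8 * m * M) ^ m * (2 * m) ^ m := by gcongr
      _ ≤ (8 * m * (2 * m0)) ^ m * (2 * m) ^ m := by gcongr
      _ = _ := by rw [← mul_pow]; ring_nf
  have e2 : δ / m * (m0 / η) * (1 / 2) * (m0 / m) ^ (m - 1) ≤ D * (c2 * (D * 2 ^ m)) := by
    refine le_trans ?_ h2
    gcongr
  have e3 : δ / m * (m0 / η) * (1 / 2) * (m0 / m) ^ (m - 1) = (δ / η) * (1 / 2) * (m0 / m) ^ m := by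
    obtain ⟨k, rfl⟩ := Nat.exists_eq_succ_of_ne_zero hm.ne'
    simp only [Nat.succ_eq_add_one, Nat.add_sub_cancel]
    rw [pow_succ]; ring
  rw [e3] at e2
  have e4 : (δ / η) * (1 / 2) * (m0 / m) ^ m * c1 ≤ c2 * (64 * m ^ 2 * m0) ^ m := by
    calc _ ≤ D * (c2 * (D * 2 ^ m)) * c1 := by gcongr
      _ = c2 * 2 ^ m * (D * D * c1) := by ring
      _ ≤ c2 * 2 ^ m * (32 * m ^ 2 * m0) ^ m := by gcongr
      _ = c2 * (64 * m ^ 2 * m0) ^ m := by rw [mul_assoc, ← mul_pow]; ring_nf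
  rw [mul_pow (64 * (m:ℝ) ^ 2), div_pow] at e4
  have hp : 0 < m0 ^ m := by positivity
  have hpm : (0:ℝ) < (m:ℝ) ^ m := by positivity
  have e5 : δ / η = ((δ / η) * (1 / 2) * (m0 ^ m / m ^ m) * c1) * (2 * m ^ m / (c1 * m0 ^ m)) := by
    generalize δ / η = r
    field_simp
  rw [e5]
  calc _ ≤ (c2 * ((64 * m ^ 2) ^ m * m0 ^ m)) * (2 * m ^ m / (c1 * m0 ^ m)) := by gcongr
    _ = _ := by field_simp

lemma core_thm {m : ℕ} (hm : 0 < m) {v : (Fin m → ℝ) → ℝ} (hv : ConvexOn ℝ univ v)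
    (hc : Continuous v) (hv0 : ∀ y, 0 ≤ v y) (hz : v 0 = 0) {R c1 c2 : ℝ} (hR : 0 < R)
    (hc1 : 0 < c1) (hc2 : 0 < c2)
    (hlow : ∀ ω, IsCompact ω → ω ⊆ Metric.closedBall 0 R →
      ENNReal.ofReal c1 * volume ω ≤ volume (sdI v ω))
    (hup : ∀ ω, IsCompact ω → ω ⊆ Metric.closedBall 0 R →
      volume (sdI v ω) ≤ ENNReal.ofReal c2 * volume ω)
    (l : Fin m → ℝ) (hl : ∀ y, v y = 0 → y ≠ 0 → l ⬝ᵥ y < 0) (y1 : Fin m → ℝ)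
    (hy1 : v y1 = 0) (hy1' : y1 ≠ 0) : False := by
  have hm' : (0:ℝ) < m := by exact_mod_cast hm
  have hlc : Continuous (fun y : Fin m → ℝ => l ⬝ᵥ y) := by unfold dotProduct; fun_prop
  obtain ⟨δ, hδ, hδ1, hδ2⟩ : ∃ δ : ℝ, 0 < δ ∧ δ ≤ - (l ⬝ᵥ y1) ∧
      ∀ y, v y = 0 → ‖y‖ = R → l ⬝ᵥ y < -δ := by
    have hcS : IsCompact (Metric.sphere (0 : Fin m → ℝ) R ∩ {y | v y = 0}) :=
      (isCompact_sphere _ _).inter_right (isClosed_eq hc continuous_const)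
    obtain ⟨a, ha, hb⟩ := hcS.exists_forall_le' (f := fun y => - (l ⬝ᵥ y)) hlc.neg.continuousOn
      (a := 0) (fun y hy => by
        have : y ≠ 0 := by
          rintro rfl
          have := hy.1
          simp at this; linarith
        have := hl y hy.2 this
        linarith)
    have := hl y1 hy1 hy1'
    refine ⟨min (a / 2) (-(l ⬝ᵥ y1)), lt_min (by linarith) (by linarith), min_le_right _ _, fun y h1 h2 => ?_⟩
    have h3 := hb y ⟨by simpa using h2, h1⟩
    have := min_le_left (a / 2) (-(l ⬝ᵥ y1))
    linarith
  set Cst : ℝ := 2 * m ^ m * (c2 / c1) * (64 * m ^ 2) ^ m with hCst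
  have hCst0 : 0 < Cst := by positivity
  set η : ℝ := δ / (Cst + 1) with hηd
  have hη : 0 < η := by positivity
  have hηδ : η ≤ δ := div_le_self hδ.le (by linarith)
  obtain ⟨B, hB, hBb⟩ : ∃ B : ℝ, 0 < B ∧ ∀ y ∈ Metric.closedBall (0 : Fin m → ℝ) R, l ⬝ᵥ y + δ ≤ B := by
    obtain ⟨a, ha, hb⟩ := (isCompact_closedBall (0 : Fin m → ℝ) R).exists_isMaxOn
      ⟨0, by simp [hR.le]⟩ (f := fun y => l ⬝ᵥ y + δ) (hlc.add continuous_const).continuousOn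
    refine ⟨l ⬝ᵥ a + δ, ?_, fun y hy => hb hy⟩
    have : l ⬝ᵥ (0 : Fin m → ℝ) + δ ≤ l ⬝ᵥ a + δ := hb (a := 0) (by simp [hR.le])
    rw [dotProduct_zero] at this
    linarith
  obtain ⟨κ, hκ, hκb⟩ : ∃ κ : ℝ, 0 < κ ∧ ∀ y ∈ Metric.closedBall (0 : Fin m → ℝ) R, -δ ≤ l ⬝ᵥ y →
      (‖y‖ = R ∨ η ≤ l ⬝ᵥ y) → κ ≤ v y := by
    have hT : IsCompact (Metric.closedBall (0 : Fin m → ℝ) R ∩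
        ({y | -δ ≤ l ⬝ᵥ y} ∩ ({y | ‖y‖ = R} ∪ {y | η ≤ l ⬝ᵥ y}))) :=
      (isCompact_closedBall _ _).inter_right ((isClosed_le continuous_const hlc).inter
        ((isClosed_eq continuous_norm continuous_const).union (isClosed_le continuous_const hlc)))
    obtain ⟨a, ha, hb⟩ := hT.exists_forall_le' (f := v) hc.continuousOn
      (a := 0) (fun y hy => by
        refine lt_of_le_of_ne (hv0 y) (fun h => ?_)
        obtain ⟨h1, h2, h3⟩ := hy
        rcases h3 with h3 | h3
        · have := hδ2 y h.symm h3
          have h2' : -δ ≤ l ⬝ᵥ y := h2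
          linarith
        · have h3' : η ≤ l ⬝ᵥ y := h3
          have : y ≠ 0 := by
            rintro rfl
            rw [dotProduct_zero] at h3'; linarith
          have := hl y h.symm this
          linarith)
    exact ⟨a, ha, fun y h1 h2 h3 => hb y ⟨h1, h2, h3⟩⟩
  set ε : ℝ := κ / (2 * B) with hε
  have hε0 : 0 < ε := by positivity
  have hεB : ε * B < κ := by
    have : ε * B = κ / 2 := by rw [hε]; field_simp
    linarith
  set w : (Fin m → ℝ) → ℝ := fun y => v y - ((ε • l) ⬝ᵥ y + ε * δ) with hw
  have hwe : ∀ y, w y = v y - ε * (l ⬝ᵥ y + δ) := by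
    intro y; simp only [hw, smul_dotProduct, smul_eq_mul]; ring
  have hwc : Continuous w := by
    have : w = fun y => v y - ε * (l ⬝ᵥ y + δ) := funext hwe
    rw [this]; fun_prop
  have hwconv : ConvexOn ℝ univ w := by
    refine ⟨convex_univ, fun a _ b _ s t hs ht hst => ?_⟩
    have := hv.2 (mem_univ a) (mem_univ b) hs ht hst
    simp only [hwe, dotProduct_add, dotProduct_smul, smul_eq_mul] at *
    have e : ε * δ = ε * δ * (s + t) := by rw [hst, mul_one]
    linarith
  set Z : Set (Fin m → ℝ) := {z | w z ≤ 0} with hZ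
  have hZconv : Convex ℝ Z := by
    have := hwconv.convex_le 0
    simpa [hZ] using this
  have hw0 : w 0 = -(ε * δ) := by rw [hwe, hz, dotProduct_zero]; ring
  have hm0 : 0 < ε * δ := by positivity
  have h0Z : (0 : Fin m → ℝ) ∈ Z := by
    show w 0 ≤ 0
    rw [hw0]; linarith
  have hZl : ∀ z ∈ Z, -δ ≤ l ⬝ᵥ z := by
    intro z hz'
    have h1 : w z ≤ 0 := hz'
    rw [hwe] at h1
    have h2 := hv0 z
    by_contra h
    push Not at h
    have : ε * (l ⬝ᵥ z + δ) < 0 := mul_neg_of_pos_of_neg hε0 (by linarith)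
    linarith
  have hZin : ∀ z ∈ Z, ‖z‖ ≤ R → ‖z‖ ≠ R ∧ l ⬝ᵥ z < η := by
    intro z hz' hzR
    have h1 : w z ≤ 0 := hz'
    rw [hwe] at h1
    have hzb : z ∈ Metric.closedBall (0 : Fin m → ℝ) R := by simpa using hzR
    have h2 := hBb z hzb
    have h3 : v z < κ := by nlinarith
    constructor
    · intro h
      have := hκb z hzb (hZl z hz') (Or.inl h)
      linarith
    · by_contra h
      have := hκb z hzb (hZl z hz') (Or.inr (not_lt.1 h))
      linarith
  have hZb : ∀ z ∈ Z, ‖z‖ ≤ R := by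
    intro z hz'
    by_contra h
    push Not at h
    have hzpos : 0 < ‖z‖ := by linarith
    have h1 : (R / ‖z‖) • z ∈ Z :=
      hZconv.smul_mem_of_zero_mem h0Z hz' ⟨by positivity, (div_le_one hzpos).2 h.le⟩
    have h2 : ‖(R / ‖z‖) • z‖ = R := by
      rw [norm_smul, Real.norm_of_nonneg (by positivity)]; field_simp
    exact (hZin _ h1 h2.le).1 h2
  have hZsub : Z ⊆ Metric.closedBall 0 R := fun z hz' => by simpa using hZb z hz'
  have hZcomp : IsCompact Z :=
    (isCompact_closedBall _ _).of_isClosed_subset (isClosed_le hwc continuous_const) hZsub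
  have hZη : ∀ z ∈ Z, l ⬝ᵥ z ≤ η := fun z hz' => (hZin z hz' (hZb z hz')).2.le
  have hZn : Z ∈ nhds 0 := by
    have : {z | w z < 0} ∈ nhds (0 : Fin m → ℝ) :=
      (isOpen_lt hwc continuous_const).mem_nhds (by show w 0 < 0; rw [hw0]; linarith)
    filter_upwards [this] with z hz'
    exact le_of_lt hz'
  obtain ⟨A, hAd, hAc, hAt⟩ := norm_matrix Z hZcomp hZn
  -- a point at level -δ
  obtain ⟨j, hj⟩ : ∃ j, δ / m ≤ |(A.transpose.mulVec l) j| := by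
    have hly := hl y1 hy1 hy1'
    set lam := δ / (-(l ⬝ᵥ y1)) with hlam
    have hlam0 : 0 ≤ lam := div_nonneg hδ.le (by linarith)
    have hlam1 : lam ≤ 1 := (div_le_one (by linarith)).2 hδ1
    have hL : l ⬝ᵥ (lam • y1) = -δ := by
      rw [dotProduct_smul, smul_eq_mul, hlam]
      have : l ⬝ᵥ y1 ≠ 0 := hly.ne
      field_simp
    have hv1 : v (lam • y1) ≤ 0 := by
      have := hv.2 (mem_univ y1) (mem_univ 0) hlam0 (sub_nonneg.2 hlam1) (by ring)
      simp only [smul_zero, add_zero, hy1, hz, smul_eq_mul, mul_zero] at this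
      exact this
    have hmem : lam • y1 ∈ Z := by
      show w _ ≤ 0
      rw [hwe, hL]; linarith
    obtain ⟨t, ht, ht1⟩ := hAt _ hmem
    rw [← ht, Matrix.dotProduct_mulVec, ← Matrix.mulVec_transpose] at hL
    by_contra hcon
    push Not at hcon
    have : |A.transpose.mulVec l ⬝ᵥ t| < δ := by
      calc |A.transpose.mulVec l ⬝ᵥ t| ≤ ∑ i, |A.transpose.mulVec l i * t i| := Finset.abs_sum_le_sum_abs _ _
        _ < ∑ i : Fin m, δ / m := by
            refine Finset.sum_lt_sum_of_nonempty ⟨⟨0, hm⟩, Finset.mem_univ _⟩ fun i _ => ?_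
            rw [abs_mul]
            have := hcon i
            have := ht1 i
            have := abs_nonneg (A.transpose.mulVec l i)
            nlinarith
        _ = δ := by simp; field_simp
    rw [hL, abs_neg, abs_of_pos hδ] at this
    exact lt_irrefl _ this
  -- lower bound
  have hM : ∀ z ∈ Z, -(ε * (δ + η)) ≤ w z := by
    intro z hz'
    rw [hwe]
    have := hv0 z
    have := hZη z hz'
    nlinarith
  have low := alex_low hm hZconv h0Z (fun z hz' => hz') hM A hAc
  set box : Set (Fin m → ℝ) := Icc (fun _ => 1 / (4 * (m:ℝ))) (fun _ => 3 / (4 * (m:ℝ))) with hbox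
  have hboxZ : Matrix.toLin' A '' box ⊆ Z := by
    rintro _ ⟨t, ht, rfl⟩
    rw [Matrix.toLin'_apply]
    refine mulVec_mem hm hZconv h0Z A hAc t fun i => ?_
    have a1 : 1 / (4 * (m:ℝ)) ≤ t i := ht.1 i
    have a2 : t i ≤ 3 / (4 * (m:ℝ)) := ht.2 i
    have e4 : 1 / (m:ℝ) = 4 * (1 / (4 * (m:ℝ))) := by field_simp
    have e43 : 3 / (4 * (m:ℝ)) = 3 * (1 / (4 * (m:ℝ))) := by ring
    have p4 : 0 < 1 / (4 * (m:ℝ)) := by positivity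
    constructor <;> linarith
  have hlinc : Continuous (Matrix.toLin' A) := LinearMap.continuous_of_finiteDimensional _
  have hboxc : IsCompact (Matrix.toLin' A '' box) := isCompact_Icc.image hlinc
  have low2 := hlow _ hboxc (hboxZ.trans hZsub)
  have hvolbox : volume (Matrix.toLin' A '' box) = ENNReal.ofReal (|A.det| * (1 / (2 * m)) ^ m) := by
    rw [Measure.addHaar_image_linearMap, LinearMap.det_toLin', hbox, Real.volume_Icc_pi]
    simp only [Finset.prod_const, Finset.card_univ, Fintype.card_fin]
    have : 3 / (4 * (m:ℝ)) - 1 / (4 * m) = 1 / (2 * m) := by field_simp; norm_num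
    rw [this, ← ENNReal.ofReal_pow (by positivity), ← ENNReal.ofReal_mul (abs_nonneg _)]
  rw [← sdI_shift v (ε • l) (ε * δ)] at low2
  have h1 : |A.det| * (c1 * (|A.det| * (1 / (2 * m)) ^ m)) ≤ (8 * m * (ε * (δ + η))) ^ m := by
    rw [hvolbox] at low2
    have := (mul_le_mul_right low2 (ENNReal.ofReal |A.det|)).trans low
    rw [← ENNReal.ofReal_mul hc1.le, ← ENNReal.ofReal_mul (abs_nonneg _)] at this
    exact (ENNReal.ofReal_le_ofReal_iff (by positivity)).1 this
  have pol := polar_vol A hAd hAt l hη hm0 hZη j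
  have up1 := measure_mono (μ := volume) (alex_up hwconv hwc hZ hZcomp hm0 hw0)
  have up2 := hup Z hZcomp hZsub
  rw [← sdI_shift v (ε • l) (ε * δ)] at up2
  have up3 : volume Z ≤ ENNReal.ofReal (|A.det| * 2 ^ m) := by
    have hsub : Z ⊆ Matrix.toLin' A '' (Icc (fun _ => -1) (fun _ => 1)) := by
      intro z hz'
      obtain ⟨t, ht, ht1⟩ := hAt z hz'
      refine ⟨t, ⟨fun i => (abs_le.1 (ht1 i)).1, fun i => (abs_le.1 (ht1 i)).2⟩, ?_⟩
      rw [Matrix.toLin'_apply, ht]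
    refine (measure_mono hsub).trans (le_of_eq ?_)
    rw [Measure.addHaar_image_linearMap, LinearMap.det_toLin', Real.volume_Icc_pi]
    simp only [Finset.prod_const, Finset.card_univ, Fintype.card_fin]
    rw [← ENNReal.ofReal_pow (by norm_num), ← ENNReal.ofReal_mul (abs_nonneg _)]
    norm_num
  have h2 : |(A.transpose.mulVec l) j| * (ε * δ / η) * (1 / 2) * (ε * δ / m) ^ (m - 1) ≤
      |A.det| * (c2 * (|A.det| * 2 ^ m)) := by
    have h3 := up1.trans (up2.trans (mul_le_mul_right up3 (ENNReal.ofReal c2)))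
    have h4 := pol.trans (mul_le_mul_right h3 (ENNReal.ofReal |A.det|))
    rw [← ENNReal.ofReal_mul hc2.le, ← ENNReal.ofReal_mul (abs_nonneg _)] at h4
    exact (ENNReal.ofReal_le_ofReal_iff (by positivity)).1 h4
  have fin := core_arith hm hc1 hc2 hη hm0 (by positivity) (by nlinarith : ε * (δ + η) ≤ 2 * (ε * δ)) hj h1 h2
  have : δ / η = Cst + 1 := by rw [hηd]; field_simp
  rw [this] at fin
  linarith

section support
variable {n : ℕ} {K : Set (EuclideanSpace ℝ (Fin n))}

lemma le_suppFn (hK : IsCompact K) (u : EuclideanSpace ℝ (Fin n)) {z : EuclideanSpace ℝ (Fin n)}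
    (hz : z ∈ K) : ⟪u, z⟫ ≤ suppFn K u := by
  refine le_csSup ?_ ⟨z, hz, rfl⟩
  exact (hK.image (by fun_prop)).bddAbove

lemma suppFn_le (hne : K.Nonempty) (u : EuclideanSpace ℝ (Fin n)) {c : ℝ}
    (h : ∀ z ∈ K, ⟪u, z⟫ ≤ c) : suppFn K u ≤ c := by
  refine csSup_le (hne.image _) ?_
  rintro _ ⟨z, hz, rfl⟩
  exact h z hz

lemma suppFn_smul (hK : IsCompact K) (hne : K.Nonempty) {c : ℝ} (hc : 0 < c)
    (u : EuclideanSpace ℝ (Fin n)) : suppFn K (c • u) = c * suppFn K u := by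
  apply le_antisymm
  · refine suppFn_le hne _ fun z hz => ?_
    rw [real_inner_smul_left]
    exact mul_le_mul_of_nonneg_left (le_suppFn hK u hz) hc.le
  · rw [← le_div_iff₀' hc]
    refine suppFn_le hne _ fun z hz => ?_
    rw [le_div_iff₀' hc, ← real_inner_smul_left]
    exact le_suppFn hK _ hz

lemma suppFn_add_le (hK : IsCompact K) (hne : K.Nonempty) (u w : EuclideanSpace ℝ (Fin n)) :
    suppFn K (u + w) ≤ suppFn K u + suppFn K w := by
  refine suppFn_le hne _ fun z hz => ?_
  rw [inner_add_left]
  exact add_le_add (le_suppFn hK _ hz) (le_suppFn hK _ hz)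

lemma suppFn_nonneg (hK : IsCompact K) (h0 : 0 ∈ K) (u : EuclideanSpace ℝ (Fin n)) :
    0 ≤ suppFn K u := by
  simpa using le_suppFn hK u h0

lemma suppFn_le_norm (hne : K.Nonempty) {B : ℝ} (hB : ∀ z ∈ K, ‖z‖ ≤ B)
    (u : EuclideanSpace ℝ (Fin n)) : suppFn K u ≤ B * ‖u‖ := by
  refine suppFn_le hne _ fun z hz => ?_
  calc ⟪u, z⟫ ≤ ‖u‖ * ‖z‖ := real_inner_le_norm _ _
    _ ≤ ‖u‖ * B := by gcongr; exact hB z hz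
    _ = _ := mul_comm _ _

lemma exists_bound (hK : IsCompact K) : ∃ B : ℝ, 0 < B ∧ ∀ z ∈ K, ‖z‖ ≤ B := by
  obtain ⟨B, hB⟩ := hK.isBounded.exists_norm_le
  exact ⟨max B 1, by positivity, fun z hz => (hB z hz).trans (le_max_left _ _)⟩

lemma suppFn_continuous (hK : IsCompact K) (hne : K.Nonempty) : Continuous (suppFn K) := by
  obtain ⟨B, hB0, hB⟩ := exists_bound hK
  refine (LipschitzWith.of_le_add_mul ⟨B, hB0.le⟩ fun u w => ?_).continuous
  have h1 := suppFn_add_le hK hne w (u - w)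
  have h2 := suppFn_le_norm hne hB (u - w)
  rw [add_sub_cancel] at h1
  rw [dist_eq_norm]
  show suppFn K u ≤ suppFn K w + B * ‖u - w‖
  linarith

lemma face_smul (hK : IsCompact K) (hne : K.Nonempty) {c : ℝ} (hc : 0 < c)
    (u : EuclideanSpace ℝ (Fin n)) : face K (c • u) = face K u := by
  ext z
  simp only [face, mem_ofPred_eq, suppFn_smul hK hne hc, real_inner_smul_right]
  refine and_congr_right fun _ => ?_
  constructor
  · intro h; exact mul_left_cancel₀ hc.ne' h
  · intro h; rw [h]

end support

lemma hausdorff_inv {X Y : Type*} [MetricSpace X] [MetricSpace Y] [MeasurableSpace X] [BorelSpace X]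
    [MeasurableSpace Y] [BorelSpace Y] (f : X → Y) (A : Set X) (C : ℝ≥0)
    (h : ∀ a ∈ A, ∀ a' ∈ A, dist a a' ≤ C * dist (f a) (f a')) {d : ℝ} (hd : 0 ≤ d) :
    μH[d] A ≤ (C : ℝ≥0∞) ^ d * μH[d] (f '' A) := by
  classical
  rcases A.eq_empty_or_nonempty with rfl | ⟨a0, ha0⟩
  · simp
  have : Nonempty X := ⟨a0⟩
  set g := Function.invFunOn f A
  have hg : ∀ y ∈ f '' A, g y ∈ A ∧ f (g y) = y := fun y hy =>
    ⟨Function.invFunOn_mem hy, Function.invFunOn_eq hy⟩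
  have hL : LipschitzOnWith C g (f '' A) := by
    refine LipschitzOnWith.of_dist_le_mul fun y hy y' hy' => ?_
    have := h _ (hg y hy).1 _ (hg y' hy').1
    rwa [(hg y hy).2, (hg y' hy').2] at this
  have himg : A ⊆ g '' (f '' A) := by
    intro a ha
    refine ⟨f a, ⟨a, ha, rfl⟩, ?_⟩
    have h1 := hg (f a) ⟨a, ha, rfl⟩
    have := h _ h1.1 _ ha
    rw [h1.2, dist_self, mul_zero] at this
    exact dist_le_zero.1 this
  exact (measure_mono himg).trans (hL.hausdorffMeasure_image_le hd)

lemma hausdorff_lip {X Y : Type*} [MetricSpace X] [MetricSpace Y] [MeasurableSpace X] [BorelSpace X]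
    [MeasurableSpace Y] [BorelSpace Y] (f : X → Y) (A : Set X) (C : ℝ≥0)
    (h : ∀ a ∈ A, ∀ a' ∈ A, dist (f a) (f a') ≤ C * dist a a') {d : ℝ} (hd : 0 ≤ d) :
    μH[d] (f '' A) ≤ (C : ℝ≥0∞) ^ d * μH[d] A :=
  (LipschitzOnWith.of_dist_le_mul h).hausdorffMeasure_image_le hd

section chart
variable {m : ℕ} (b : OrthonormalBasis (Fin (m+1)) ℝ (EuclideanSpace ℝ (Fin (m+1))))
  {K : Set (EuclideanSpace ℝ (Fin (m+1)))}

/-- affine chart of the normals -/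
def uu (y : Fin m → ℝ) : EuclideanSpace ℝ (Fin (m+1)) := b 0 + ∑ i, y i • b i.succ

/-- coordinate projection -/
def pp (z : EuclideanSpace ℝ (Fin (m+1))) : Fin m → ℝ := fun i => ⟪b i.succ, z⟫

/-- normalized chart -/
def nu (y : Fin m → ℝ) : EuclideanSpace ℝ (Fin (m+1)) := ‖uu b y‖⁻¹ • uu b y

lemma inner_uu (y : Fin m → ℝ) (z : EuclideanSpace ℝ (Fin (m+1))) :
    ⟪uu b y, z⟫ = ⟪b 0, z⟫ + y ⬝ᵥ pp b z := by
  simp [uu, pp, inner_add_left, sum_inner, real_inner_smul_left, dotProduct]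

lemma inner_b0_uu (y : Fin m → ℝ) : ⟪b 0, uu b y⟫ = 1 := by
  have h : ∀ i : Fin m, ⟪b 0, b i.succ⟫ = 0 := fun i => b.orthonormal.2 (Fin.succ_ne_zero i).symm
  simp [uu, inner_add_right, inner_sum, real_inner_smul_right, h]

lemma pp_uu (y : Fin m → ℝ) : pp b (uu b y) = y := by
  ext j
  have h : ⟪b j.succ, b 0⟫ = 0 := b.orthonormal.2 (Fin.succ_ne_zero j)
  have h2 : ∀ i : Fin m, ⟪b j.succ, b i.succ⟫ = if j = i then 1 else 0 := fun i => by
    rw [orthonormal_iff_ite.1 b.orthonormal]; simp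
  simp [pp, uu, inner_add_right, inner_sum, real_inner_smul_right, h, h2]

lemma uu_decomp (z : EuclideanSpace ℝ (Fin (m+1))) :
    z = ⟪b 0, z⟫ • b 0 + ∑ i, pp b z i • b i.succ := by
  have := b.sum_repr z
  rw [Fin.sum_univ_succ] at this
  simp only [b.repr_apply_apply] at this
  exact this.symm

lemma one_le_norm_uu (y : Fin m → ℝ) : 1 ≤ ‖uu b y‖ := by
  have h := real_inner_le_norm (b 0) (uu b y)
  rw [inner_b0_uu] at h
  simpa using h

lemma uu_continuous : Continuous (uu b) := by unfold uu; fun_prop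

lemma pp_le (z : EuclideanSpace ℝ (Fin (m+1))) : ‖pp b z‖ ≤ ‖z‖ := by
  rw [pi_norm_le_iff_of_nonneg (norm_nonneg _)]
  intro i
  have := abs_real_inner_le_norm (b i.succ) z
  simpa [pp] using this

lemma pp_sub (z z' : EuclideanSpace ℝ (Fin (m+1))) : pp b (z - z') = pp b z - pp b z' := by
  ext i; simp [pp, inner_sub_right]

lemma pp_smul (c : ℝ) (z : EuclideanSpace ℝ (Fin (m+1))) : pp b (c • z) = c • pp b z := by
  ext i; simp [pp, real_inner_smul_right]

lemma norm_le_coords (z : EuclideanSpace ℝ (Fin (m+1))) :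
    ‖z‖ ≤ |⟪b 0, z⟫| + m * ‖pp b z‖ := by
  conv_lhs => rw [uu_decomp b z]
  refine (norm_add_le _ _).trans (add_le_add ?_ ?_)
  · rw [norm_smul]; simp
  · refine (norm_sum_le _ _).trans ?_
    calc ∑ i, ‖pp b z i • b i.succ‖ ≤ ∑ i : Fin m, ‖pp b z‖ := by
          refine Finset.sum_le_sum fun i _ => ?_
          rw [norm_smul]; simpa using norm_le_pi_norm (pp b z) i
      _ = _ := by simp

lemma uu_sub (y y' : Fin m → ℝ) : ‖uu b y - uu b y'‖ ≤ m * ‖y - y'‖ := by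
  have h := norm_le_coords b (uu b y - uu b y')
  rwa [inner_sub_right, inner_b0_uu, inner_b0_uu, sub_self, abs_zero, zero_add, pp_sub, pp_uu, pp_uu] at h

lemma abs_dot_le (y q : Fin m → ℝ) : |y ⬝ᵥ q| ≤ m * ‖y‖ * ‖q‖ := by
  calc |y ⬝ᵥ q| ≤ ∑ i, |y i * q i| := Finset.abs_sum_le_sum_abs _ _
    _ ≤ ∑ i : Fin m, ‖y‖ * ‖q‖ := by
        refine Finset.sum_le_sum fun i _ => ?_
        rw [abs_mul]
        exact mul_le_mul (norm_le_pi_norm y i) (norm_le_pi_norm q i) (abs_nonneg _) (norm_nonneg _)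
    _ = _ := by simp; ring

lemma norm_uu_le (y : Fin m → ℝ) : ‖uu b y‖ ≤ 1 + m * ‖y‖ := by
  have h := norm_le_coords b (uu b y)
  rwa [inner_b0_uu, abs_one, pp_uu] at h

lemma nu_lip (y y' : Fin m → ℝ) : ‖nu b y - nu b y'‖ ≤ 2 * m * ‖y - y'‖ := by
  have h1 := one_le_norm_uu b y
  have h2 := one_le_norm_uu b y'
  set a := uu b y
  set a' := uu b y'
  have hA : 0 < ‖a‖ := by linarith
  have hA' : 0 < ‖a'‖ := by linarith
  have e : nu b y - nu b y' = ‖a‖⁻¹ • (a - a') + (‖a‖⁻¹ * (‖a'‖ - ‖a‖)) • (‖a'‖⁻¹ • a') := by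
    simp only [nu]
    rw [smul_sub, smul_smul]
    have : ‖a‖⁻¹ * (‖a'‖ - ‖a‖) * ‖a'‖⁻¹ = ‖a‖⁻¹ - ‖a'‖⁻¹ := by field_simp
    rw [this, sub_smul]
    abel
  have h3 := uu_sub b y y'
  have h4 : |‖a'‖ - ‖a‖| ≤ ‖a - a'‖ := by rw [norm_sub_rev]; exact abs_norm_sub_norm_le _ _
  have hi : ‖a‖⁻¹ ≤ 1 := inv_le_one_of_one_le₀ h1
  rw [e]
  calc _ ≤ ‖‖a‖⁻¹ • (a - a')‖ + ‖(‖a‖⁻¹ * (‖a'‖ - ‖a‖)) • (‖a'‖⁻¹ • a')‖ := norm_add_le _ _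
    _ = ‖a‖⁻¹ * ‖a - a'‖ + ‖a‖⁻¹ * |‖a'‖ - ‖a‖| := by
        rw [norm_smul, norm_smul, norm_smul, norm_mul, norm_inv, norm_norm, norm_inv, norm_norm,
          inv_mul_cancel₀ hA'.ne', mul_one, Real.norm_eq_abs]
    _ ≤ 1 * ‖a - a'‖ + 1 * ‖a - a'‖ := by gcongr
    _ ≤ 2 * m * ‖y - y'‖ := by linarith

lemma nu_anti {R : ℝ} {y y' : Fin m → ℝ} (hy : ‖y‖ ≤ R) (hy' : ‖y'‖ ≤ R) :
    ‖y - y'‖ ≤ (1 + m * R) * (1 + R) * ‖nu b y - nu b y'‖ := by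
  have h1 := one_le_norm_uu b y
  have h2 := one_le_norm_uu b y'
  have hA : 0 < ‖uu b y‖ := by linarith
  have hA' : 0 < ‖uu b y'‖ := by linarith
  have hR : 0 ≤ R := (norm_nonneg _).trans hy
  have p1 : pp b (nu b y) = ‖uu b y‖⁻¹ • y := by rw [nu, pp_smul, pp_uu]
  have p2 : pp b (nu b y') = ‖uu b y'‖⁻¹ • y' := by rw [nu, pp_smul, pp_uu]
  have q1 : ⟪b 0, nu b y⟫ = ‖uu b y‖⁻¹ := by rw [nu, real_inner_smul_right, inner_b0_uu, mul_one]
  have q2 : ⟪b 0, nu b y'⟫ = ‖uu b y'‖⁻¹ := by rw [nu, real_inner_smul_right, inner_b0_uu, mul_one]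
  have e : y - y' = ‖uu b y‖ • (pp b (nu b y - nu b y') - ⟪b 0, nu b y - nu b y'⟫ • y') := by
    rw [pp_sub, inner_sub_right, p1, p2, q1, q2, sub_smul, smul_sub, smul_sub, smul_sub, smul_smul, smul_smul, mul_inv_cancel₀ hA.ne',
      one_smul, smul_smul, mul_inv_cancel₀ hA.ne', one_smul]
    abel
  have h3 : ‖uu b y‖ ≤ 1 + m * R := (norm_uu_le b y).trans (by gcongr)
  have h4 : |⟪b 0, nu b y - nu b y'⟫| ≤ ‖nu b y - nu b y'‖ := by
    simpa using abs_real_inner_le_norm (b 0) (nu b y - nu b y')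
  have h5 := pp_le b (nu b y - nu b y')
  calc ‖y - y'‖ = ‖uu b y‖ * ‖pp b (nu b y - nu b y') - ⟪b 0, nu b y - nu b y'⟫ • y'‖ := by
        conv_lhs => rw [e]
        rw [norm_smul, norm_norm]
    _ ≤ (1 + m * R) * (‖nu b y - nu b y'‖ + ‖nu b y - nu b y'‖ * R) := by
        gcongr
        refine (norm_sub_le _ _).trans (add_le_add h5 ?_)
        rw [norm_smul, Real.norm_eq_abs]
        gcongr
    _ = _ := by ring

lemma nu_continuous : Continuous (nu b) := by
  unfold nu
  have h := uu_continuous b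
  exact (h.norm.inv₀ fun y => (lt_of_lt_of_le one_pos (one_le_norm_uu b y)).ne').smul h

lemma nu_mem (y : Fin m → ℝ) : nu b y ∈ unitSphere (m+1) := by
  have : ‖uu b y‖ ≠ 0 := (lt_of_lt_of_le one_pos (one_le_norm_uu b y)).ne'
  simp [unitSphere, nu, norm_smul, this]

lemma face_nu (hK : IsCompact K) (hne : K.Nonempty) (y : Fin m → ℝ) :
    face K (nu b y) = face K (uu b y) :=
  face_smul hK hne (inv_pos.2 (lt_of_lt_of_le one_pos (one_le_norm_uu b y))) _

/-- faces project onto subdifferentials -/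
lemma pp_face (hK : IsCompact K) (hconv : Convex ℝ K) (hne : K.Nonempty) (y : Fin m → ℝ) :
    pp b '' face K (uu b y) = sdf (fun y => suppFn K (uu b y)) y := by
  ext q
  constructor
  · rintro ⟨z, ⟨hz, he⟩, rfl⟩ y'
    have h1 := le_suppFn hK (uu b y') hz
    rw [real_inner_comm] at he
    show suppFn K (uu b y) + _ ≤ suppFn K (uu b y')
    rw [← he]
    rw [inner_uu] at h1 ⊢
    rw [dotProduct_sub, dotProduct_comm _ y, dotProduct_comm _ y']
    linarith
  · intro hq
    have hq' : ∀ y', suppFn K (uu b y) + q ⬝ᵥ (y' - y) ≤ suppFn K (uu b y') := hq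
    set z : EuclideanSpace ℝ (Fin (m+1)) :=
      (suppFn K (uu b y) - q ⬝ᵥ y) • b 0 + ∑ i, q i • b i.succ with hz
    have hz0 : ⟪b 0, z⟫ = suppFn K (uu b y) - q ⬝ᵥ y := by
      have h : ∀ i : Fin m, ⟪b 0, b i.succ⟫ = 0 := fun i => b.orthonormal.2 (Fin.succ_ne_zero i).symm
      simp [hz, inner_add_right, inner_sum, real_inner_smul_right, h]
    have hzp : pp b z = q := by
      ext j
      have h : ⟪b j.succ, b 0⟫ = 0 := b.orthonormal.2 (Fin.succ_ne_zero j)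
      have h2 : ∀ i : Fin m, ⟪b j.succ, b i.succ⟫ = if j = i then 1 else 0 := fun i => by
        rw [orthonormal_iff_ite.1 b.orthonormal]; simp
      simp [pp, hz, inner_add_right, inner_sum, real_inner_smul_right, h, h2]
    have hzu : ∀ y', ⟪uu b y', z⟫ ≤ suppFn K (uu b y') := by
      intro y'
      have := hq' y'
      rw [inner_uu, hz0, hzp, dotProduct_comm y']
      rw [dotProduct_sub] at this
      linarith
    have hzy : ⟪uu b y, z⟫ = suppFn K (uu b y) := by
      rw [inner_uu, hz0, hzp, dotProduct_comm y]; ring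
    have hpos : ∀ w, 0 < ⟪b 0, w⟫ → ⟪w, z⟫ ≤ suppFn K w := by
      intro w hw
      have : w = ⟪b 0, w⟫ • uu b (⟪b 0, w⟫⁻¹ • pp b w) := by
        conv_lhs => rw [uu_decomp b w]
        rw [uu, smul_add, Finset.smul_sum]
        congr 1
        refine Finset.sum_congr rfl fun i _ => ?_
        rw [smul_smul, Pi.smul_apply, smul_eq_mul, mul_inv_cancel_left₀ hw.ne']
      rw [this, suppFn_smul hK hne hw, real_inner_smul_left]
      exact mul_le_mul_of_nonneg_left (hzu _) hw.le
    have hzK : z ∈ K := by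
      by_contra hzn
      obtain ⟨f, c, hf1, hf2⟩ := geometric_hahn_banach_point_closed hconv hK.isClosed hzn
      set w := -((InnerProductSpace.toDual ℝ (EuclideanSpace ℝ (Fin (m+1)))).symm f) with hw
      have hwi : ∀ a, ⟪w, a⟫ = - f a := fun a => by
        rw [hw, inner_neg_left, InnerProductSpace.toDual_symm_apply]
      have hwK : suppFn K w ≤ -c := suppFn_le hne _ fun a ha => by
        rw [hwi]; linarith [hf2 a ha]
      set lam := |⟪b 0, w⟫| + 1 with hlam
      have hlam0 : 0 < lam := by positivity
      have h1 := hpos (w + lam • uu b y) (by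
        rw [inner_add_right, real_inner_smul_right, inner_b0_uu]
        have := neg_abs_le ⟪b 0, w⟫
        linarith)
      have h2 := suppFn_add_le hK hne w (lam • uu b y)
      rw [suppFn_smul hK hne hlam0] at h2
      rw [inner_add_left, real_inner_smul_left, hzy, hwi] at h1
      linarith
    exact ⟨z, ⟨hzK, by rw [real_inner_comm]; exact hzy⟩, hzp⟩

lemma face_anti (hK : IsCompact K) {R : ℝ} {y y' : Fin m → ℝ} (hy : ‖y‖ ≤ R) (hy' : ‖y'‖ ≤ R)
    {z z' : EuclideanSpace ℝ (Fin (m+1))} (hz : z ∈ face K (uu b y)) (hz' : z' ∈ face K (uu b y')) :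
    ‖z - z'‖ ≤ (m * R + m) * ‖pp b z - pp b z'‖ := by
  have h1 : ⟪uu b y, z'⟫ ≤ ⟪uu b y, z⟫ := by
    rw [real_inner_comm z, hz.2]; exact le_suppFn hK _ hz'.1
  have h2 : ⟪uu b y', z⟫ ≤ ⟪uu b y', z'⟫ := by
    rw [real_inner_comm z', hz'.2]; exact le_suppFn hK _ hz.1
  simp only [inner_uu] at h1 h2
  have a1 := abs_le.1 ((abs_dot_le y (pp b z - pp b z')).trans
    (by gcongr : (m:ℝ) * ‖y‖ * ‖pp b z - pp b z'‖ ≤ m * R * ‖pp b z - pp b z'‖))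
  have a2 := abs_le.1 ((abs_dot_le y' (pp b z - pp b z')).trans
    (by gcongr : (m:ℝ) * ‖y'‖ * ‖pp b z - pp b z'‖ ≤ m * R * ‖pp b z - pp b z'‖))
  rw [dotProduct_sub] at a1 a2
  have h3 := norm_le_coords b (z - z')
  rw [pp_sub, inner_sub_right] at h3
  have h4 : |⟪b 0, z⟫ - ⟪b 0, z'⟫| ≤ m * R * ‖pp b z - pp b z'‖ :=
    abs_le.2 ⟨by linarith, by linarith⟩
  linarith
end chart

lemma hausdorff_inv' {X Y : Type*} [MetricSpace X] [MetricSpace Y] [MeasurableSpace X] [BorelSpace X]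
    [MeasurableSpace Y] [BorelSpace Y] (f : X → Y) (A : Set X) {C : ℝ} (hC : 0 ≤ C)
    (h : ∀ a ∈ A, ∀ a' ∈ A, dist a a' ≤ C * dist (f a) (f a')) (m : ℕ) :
    μH[(m:ℝ)] A ≤ ENNReal.ofReal (C ^ m) * μH[(m:ℝ)] (f '' A) := by
  have := hausdorff_inv f A C.toNNReal (by rwa [Real.coe_toNNReal C hC]) (d := m) (by positivity)
  rw [ENNReal.rpow_natCast] at this
  rw [ENNReal.ofReal_pow hC]
  exact this

lemma hausdorff_lip' {X Y : Type*} [MetricSpace X] [MetricSpace Y] [MeasurableSpace X] [BorelSpace X]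
    [MeasurableSpace Y] [BorelSpace Y] (f : X → Y) (A : Set X) {C : ℝ} (hC : 0 ≤ C)
    (h : ∀ a ∈ A, ∀ a' ∈ A, dist (f a) (f a') ≤ C * dist a a') (m : ℕ) :
    μH[(m:ℝ)] (f '' A) ≤ ENNReal.ofReal (C ^ m) * μH[(m:ℝ)] A := by
  have := hausdorff_lip f A C.toNNReal (by rwa [Real.coe_toNNReal C hC]) (d := m) (by positivity)
  rw [ENNReal.rpow_natCast] at this
  rw [ENNReal.ofReal_pow hC]
  exact this

lemma vol_eq (m : ℕ) : (μH[(m:ℝ)] : Measure (Fin m → ℝ)) = volume := by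
  have := hausdorffMeasure_pi_real (ι := Fin m)
  rwa [Fintype.card_fin] at this

section bounds
variable {m : ℕ} (b : OrthonormalBasis (Fin (m+1)) ℝ (EuclideanSpace ℝ (Fin (m+1))))
  {K : Set (EuclideanSpace ℝ (Fin (m+1)))}

lemma pp_faces (hK : IsCompact K) (hconv : Convex ℝ K) (hne : K.Nonempty) (ω : Set (Fin m → ℝ)) :
    pp b '' (⋃ y ∈ ω, face K (uu b y)) = sdI (fun y => suppFn K (uu b y)) ω := by
  simp only [sdI, image_iUnion, pp_face b hK hconv hne]

lemma suppFn_nu (hK : IsCompact K) (hne : K.Nonempty) (y : Fin m → ℝ) :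
    suppFn K (nu b y) = ‖uu b y‖⁻¹ * suppFn K (uu b y) :=
  suppFn_smul hK hne (inv_pos.2 (lt_of_lt_of_le one_pos (one_le_norm_uu b y))) _

lemma lower_bd (hm : 0 < m) {p τ1 : ℝ} (hp : p < 1) (hτ1 : 0 < τ1)
    {f : EuclideanSpace ℝ (Fin (m+1)) → ℝ} (hf : ∀ u ∈ unitSphere (m+1), τ1 < f u)
    (hK : IsConvexBody0 K) (hsol : IsLpSolution p f K) {R : ℝ} (hR : 0 ≤ R) :
    ∃ c : ℝ, 0 < c ∧ ∀ ω, IsCompact ω → ω ⊆ Metric.closedBall 0 R → ∀ t : ℝ, 0 < t →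
      (∀ y ∈ ω, suppFn K (uu b y) ≤ t) →
      ENNReal.ofReal (c * t ^ (p - 1)) * volume ω ≤ volume (sdI (fun y => suppFn K (uu b y)) ω) := by
  obtain ⟨hcK, hconv, -, h0⟩ := hK
  have hne : K.Nonempty := ⟨0, h0⟩
  obtain ⟨hs1, hs2⟩ := hsol
  have hm' : (0:ℝ) < m := by exact_mod_cast hm
  have hd : ((m + 1 : ℕ) : ℝ) - 1 = m := by push_cast; ring
  simp only [surfMeas, hd] at hs1 hs2
  set C1 : ℝ := (1 + m * R) * (1 + R) with hC1
  set C2 : ℝ := m * R + m with hC2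
  have hC1p : 0 < C1 := by positivity
  have hC2p : 0 < C2 := by positivity
  set a : ℝ := ((m + 1 : ℕ) : ℝ) * τ1 with ha
  have hap : 0 < a := by positivity
  refine ⟨a / (C1 ^ m * C2 ^ m), by positivity, fun ω hω hωR t ht hωt => ?_⟩
  have hωR' : ∀ y ∈ ω, ‖y‖ ≤ R := fun y hy => by simpa using hωR hy
  set ω' := nu b '' ω ∩ {u | 0 < suppFn K u} with hω'
  have hmeas : MeasurableSet ω' := (hω.image (nu_continuous b)).measurableSet.inter
    (isOpen_lt continuous_const (suppFn_continuous hcK hne)).measurableSet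
  have hsub : ω' ⊆ {u ∈ unitSphere (m+1) | 0 < suppFn K u} := by
    rintro u ⟨⟨y, hy, rfl⟩, hu⟩
    exact ⟨nu_mem b y, hu⟩
  have s1 : volume ω ≤ ENNReal.ofReal (C1 ^ m) * μH[(m:ℝ)] ω' := by
    rw [← vol_eq]
    refine (hausdorff_inv' (nu b) ω hC1p.le (fun y hy y' hy' => ?_) m).trans ?_
    · rw [dist_eq_norm, dist_eq_norm]
      exact nu_anti b (hωR' y hy) (hωR' y' hy')
    · refine mul_le_mul_right ?_ _
      have : nu b '' ω ⊆ ω' ∪ {u ∈ unitSphere (m+1) | suppFn K u = 0} := by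
        rintro u hu
        have hu1 : u ∈ unitSphere (m+1) := by
          obtain ⟨y, hy, rfl⟩ := hu; exact nu_mem b y
        rcases (suppFn_nonneg hcK h0 u).lt_or_eq with h | h
        · exact Or.inl ⟨hu, h⟩
        · exact Or.inr ⟨hu1, h.symm⟩
      have h9 := (measure_mono (μ := μH[(m:ℝ)]) this).trans (measure_union_le _ _)
      rwa [hs1, add_zero] at h9
  have s2 : ENNReal.ofReal (a * t ^ (p - 1)) * μH[(m:ℝ)] ω' ≤
      μH[(m:ℝ)] (⋃ u ∈ ω', face K u) := by
    rw [hs2 ω' hmeas hsub, ← setLIntegral_const]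
    refine setLIntegral_mono' hmeas fun u hu => ?_
    apply ENNReal.ofReal_le_ofReal
    have hu' := hsub hu
    obtain ⟨⟨y, hy, rfl⟩, hupos⟩ := hu
    have h1 : suppFn K (nu b y) ≤ t := by
      rw [suppFn_nu b hcK hne]
      have h2 : ‖uu b y‖⁻¹ ≤ 1 := inv_le_one_of_one_le₀ (one_le_norm_uu b y)
      have h3 := suppFn_nonneg hcK h0 (uu b y)
      have h4 := hωt y hy
      nlinarith
    have h5 : t ^ (p - 1) ≤ suppFn K (nu b y) ^ (p - 1) :=
      Real.rpow_le_rpow_of_nonpos hupos h1 (by linarith)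
    have h6 := (hf _ hu'.1).le
    rw [ha]
    have h8 : 0 ≤ f (nu b y) := hτ1.le.trans h6
    gcongr
  have s3 : μH[(m:ℝ)] (⋃ u ∈ ω', face K u) ≤
      ENNReal.ofReal (C2 ^ m) * volume (sdI (fun y => suppFn K (uu b y)) ω) := by
    rw [← pp_faces b hcK hconv hne, ← vol_eq]
    refine (measure_mono ?_).trans (hausdorff_inv' (pp b) (⋃ y ∈ ω, face K (uu b y)) hC2p.le ?_ m)
    · intro z hz
      simp only [mem_iUnion, exists_prop] at hz ⊢
      obtain ⟨u, ⟨⟨y, hy, rfl⟩, -⟩, hz⟩ := hz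
      exact ⟨y, hy, by rwa [face_nu b hcK hne] at hz⟩
    · intro z hz z' hz'
      simp only [mem_iUnion, exists_prop] at hz hz'
      obtain ⟨y, hy, hz⟩ := hz
      obtain ⟨y', hy', hz'⟩ := hz'
      rw [dist_eq_norm, dist_eq_norm]
      exact face_anti b hcK (hωR' y hy) (hωR' y' hy') hz hz'
  have ht' : 0 < t ^ (p - 1) := Real.rpow_pos_of_pos ht _
  calc ENNReal.ofReal (a / (C1 ^ m * C2 ^ m) * t ^ (p - 1)) * volume ω
      ≤ ENNReal.ofReal (a / (C1 ^ m * C2 ^ m) * t ^ (p - 1)) * (ENNReal.ofReal (C1 ^ m) * μH[(m:ℝ)] ω') := by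
        gcongr
    _ = ENNReal.ofReal ((C2 ^ m)⁻¹) * (ENNReal.ofReal (a * t ^ (p - 1)) * μH[(m:ℝ)] ω') := by
        rw [← mul_assoc, ← mul_assoc, ← ENNReal.ofReal_mul (by positivity), ← ENNReal.ofReal_mul (by positivity)]
        congr 2
        field_simp
    _ ≤ ENNReal.ofReal ((C2 ^ m)⁻¹) * (ENNReal.ofReal (C2 ^ m) * volume (sdI (fun y => suppFn K (uu b y)) ω)) := by
        exact mul_le_mul_right (s2.trans s3) _
    _ = _ := by
        rw [← mul_assoc, ← ENNReal.ofReal_mul (by positivity), inv_mul_cancel₀ (by positivity),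
          ENNReal.ofReal_one, one_mul]

lemma upper_bd (hm : 0 < m) {p τ2 : ℝ} (hp : p < 1) (hτ2 : 0 < τ2)
    {f : EuclideanSpace ℝ (Fin (m+1)) → ℝ} (hf : ∀ u ∈ unitSphere (m+1), f u < τ2)
    (hK : IsConvexBody0 K) (hsol : IsLpSolution p f K) {R s : ℝ} (hR : 0 ≤ R) (hs : 0 < s) :
    ∃ c : ℝ, 0 < c ∧ ∀ ω, IsCompact ω → ω ⊆ Metric.closedBall 0 R →
      (∀ y ∈ ω, s ≤ suppFn K (uu b y)) →
      volume (sdI (fun y => suppFn K (uu b y)) ω) ≤ ENNReal.ofReal c * volume ω := by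
  obtain ⟨hcK, hconv, -, h0⟩ := hK
  have hne : K.Nonempty := ⟨0, h0⟩
  obtain ⟨hs1, hs2⟩ := hsol
  have hm' : (0:ℝ) < m := by exact_mod_cast hm
  have hd : ((m + 1 : ℕ) : ℝ) - 1 = m := by push_cast; ring
  simp only [surfMeas, hd] at hs1 hs2
  set s' : ℝ := (1 + m * R)⁻¹ * s with hs'
  have hs'p : 0 < s' := by positivity
  set a : ℝ := ((m + 1 : ℕ) : ℝ) * τ2 * s' ^ (p - 1) with ha
  have hap : 0 < a := by
    have := Real.rpow_pos_of_pos hs'p (p - 1)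
    positivity
  refine ⟨a * (2 * m) ^ m, by positivity, fun ω hω hωR hωs => ?_⟩
  have hωR' : ∀ y ∈ ω, ‖y‖ ≤ R := fun y hy => by simpa using hωR hy
  have hsle : ∀ y ∈ ω, s' ≤ suppFn K (nu b y) := by
    intro y hy
    rw [suppFn_nu b hcK hne, hs']
    have h1 := one_le_norm_uu b y
    have h2 := hωs y hy
    have h3 : ‖uu b y‖ ≤ 1 + m * R := (norm_uu_le b y).trans (by have := hωR' y hy; gcongr)
    gcongr
  have hmeas : MeasurableSet (nu b '' ω) := (hω.image (nu_continuous b)).measurableSet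
  have hsub : nu b '' ω ⊆ {u ∈ unitSphere (m+1) | 0 < suppFn K u} := by
    rintro u ⟨y, hy, rfl⟩
    exact ⟨nu_mem b y, hs'p.trans_le (hsle y hy)⟩
  have s1 : μH[(m:ℝ)] (nu b '' ω) ≤ ENNReal.ofReal ((2 * m) ^ m) * volume ω := by
    rw [← vol_eq]
    refine hausdorff_lip' (nu b) ω (by positivity) (fun y hy y' hy' => ?_) m
    rw [dist_eq_norm, dist_eq_norm]
    exact nu_lip b y y'
  have s2 : μH[(m:ℝ)] (⋃ u ∈ nu b '' ω, face K u) ≤ ENNReal.ofReal a * μH[(m:ℝ)] (nu b '' ω) := by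
    rw [hs2 _ hmeas hsub, ← setLIntegral_const]
    refine setLIntegral_mono' hmeas fun u hu => ?_
    apply ENNReal.ofReal_le_ofReal
    have hu' := hsub hu
    obtain ⟨y, hy, rfl⟩ := hu
    have h5 : suppFn K (nu b y) ^ (p - 1) ≤ s' ^ (p - 1) :=
      Real.rpow_le_rpow_of_nonpos hs'p (hsle y hy) (by linarith)
    have h6 := (hf _ hu'.1).le
    have h7 : 0 ≤ suppFn K (nu b y) ^ (p - 1) := Real.rpow_nonneg hu'.2.le _
    rw [ha]
    gcongr
  have s3 : volume (sdI (fun y => suppFn K (uu b y)) ω) ≤ μH[(m:ℝ)] (⋃ u ∈ nu b '' ω, face K u) := by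
    rw [← pp_faces b hcK hconv hne, ← vol_eq]
    have e : (⋃ u ∈ nu b '' ω, face K u) = ⋃ y ∈ ω, face K (uu b y) := by
      simp only [biUnion_image, face_nu b hcK hne]
    rw [e]
    have := hausdorff_lip' (pp b) (⋃ y ∈ ω, face K (uu b y)) (C := 1) zero_le_one (fun z _ z' _ => by
      rw [dist_eq_norm, dist_eq_norm, one_mul, ← pp_sub]; exact pp_le b _) m
    simpa using this
  calc _ ≤ _ := s3.trans s2
    _ ≤ ENNReal.ofReal a * (ENNReal.ofReal ((2 * m) ^ m) * volume ω) := by gcongr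
    _ = _ := by rw [← mul_assoc, ← ENNReal.ofReal_mul hap.le]
end bounds

lemma box_vol {m : ℕ} (j : Fin m) {α β : ℝ} (hα : 0 ≤ α) (hβ : 0 ≤ β) :
    volume (Icc (fun k : Fin m => if k = j then -α else -β) (fun k => if k = j then α else β)) =
      ENNReal.ofReal (2 * α * (2 * β) ^ (m - 1)) := by
  rw [Real.volume_Icc_pi, ← ENNReal.ofReal_prod_of_nonneg]
  · congr 1
    rw [← Finset.mul_prod_erase _ _ (Finset.mem_univ j)]
    have : ∏ k ∈ Finset.univ.erase j, ((if k = j then α else β) - (if k = j then -α else -β)) =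
        ∏ k ∈ Finset.univ.erase j, (2 * β) := by
      refine Finset.prod_congr rfl fun k hk => ?_
      simp only [Finset.ne_of_mem_erase hk, if_false]; ring
    rw [this, Finset.prod_const, Finset.card_erase_of_mem (Finset.mem_univ j)]
    simp only [if_true, Finset.card_univ, Fintype.card_fin]
    ring
  · intro k _
    split_ifs <;> linarith

lemma rpow_contra {e C : ℝ} (he : e < 0) (hC : 0 ≤ C) (h : ∀ ε : ℝ, 0 < ε → ε ≤ 1 → ε ^ e ≤ C) : False := by
  have h1 : (1:ℝ) ≤ C + 1 := by linarith
  have h2 := h ((C + 1) ^ (1 / e)) (by positivity)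
    (Real.rpow_le_one_of_one_le_of_nonpos h1 (by rw [one_div]; exact (inv_lt_zero.2 he).le))
  rw [← Real.rpow_mul (by positivity), one_div, inv_mul_cancel₀ he.ne, Real.rpow_one] at h2
  linarith

lemma exists_basis1 {m : ℕ} (u0 : EuclideanSpace ℝ (Fin (m+1))) (h : ‖u0‖ = 1) :
    ∃ b : OrthonormalBasis (Fin (m+1)) ℝ (EuclideanSpace ℝ (Fin (m+1))), b 0 = u0 := by
  have ho : Orthonormal ℝ (({0} : Set (Fin (m+1))).domRestrict (fun _ => u0)) := by
    constructor
    · intro i; exact h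
    · rintro ⟨i, hi⟩ ⟨k, hk⟩ hik
      exact absurd (Subtype.ext (hi.trans hk.symm)) hik
  obtain ⟨b, hb⟩ := ho.exists_orthonormalBasis_extension_of_card_eq (by simp)
  exact ⟨b, hb 0 rfl⟩

lemma exists_basis2 {m : ℕ} (j : Fin m) (u0 u1 : EuclideanSpace ℝ (Fin (m+1))) (h0 : ‖u0‖ = 1)
    (h1 : ‖u1‖ = 1) (h01 : ⟪u0, u1⟫ = 0) :
    ∃ b : OrthonormalBasis (Fin (m+1)) ℝ (EuclideanSpace ℝ (Fin (m+1))), b 0 = u0 ∧ b j.succ = u1 := by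
  have ho : Orthonormal ℝ (({0, j.succ} : Set (Fin (m+1))).domRestrict
      (fun i => if i = 0 then u0 else u1)) := by
    constructor
    · rintro ⟨i, hi⟩
      simp only [Set.domRestrict_apply]
      split_ifs <;> assumption
    · rintro ⟨i, hi⟩ ⟨k, hk⟩ hik
      simp only [Set.domRestrict_apply]
      rcases hi with rfl | rfl <;> rcases hk with rfl | rfl
      · exact absurd rfl hik
      · simpa using h01
      · simpa [real_inner_comm] using h01
      · exact absurd rfl hik
  obtain ⟨b, hb⟩ := ho.exists_orthonormalBasis_extension_of_card_eq (by simp)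
  refine ⟨b, by simpa using hb 0 (by simp), by simpa using hb j.succ (by simp)⟩

lemma partA {m : ℕ} (hm : 0 < m) {K : Set (EuclideanSpace ℝ (Fin (m+1)))} {p τ1 : ℝ} (hp : p < 1)
    (hpm : p + m < 3) (hτ1 : 0 < τ1)
    {f : EuclideanSpace ℝ (Fin (m+1)) → ℝ} (hf : ∀ u ∈ unitSphere (m+1), τ1 < f u)
    (hK : IsConvexBody0 K) (hsol : IsLpSolution p f K) (a a' : EuclideanSpace ℝ (Fin (m+1)))
    (ha : ‖a‖ = 1) (ha' : ‖a'‖ = 1) (hne1 : a ≠ a') (hne2 : a ≠ -a')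
    (hz : ∀ s t : ℝ, 0 ≤ s → 0 ≤ t → suppFn K (s • a + t • a') = 0) : False := by
  have hm' : (0:ℝ) < m := by exact_mod_cast hm
  set j : Fin m := ⟨0, hm⟩ with hj
  have hP : 0 < ‖a + a'‖ := norm_pos_iff.2 fun h => hne2 (eq_neg_of_add_eq_zero_left h)
  have hD : 0 < ‖a - a'‖ := norm_pos_iff.2 (sub_ne_zero.2 hne1)
  obtain ⟨b, hb0, hb1⟩ := exists_basis2 j (‖a + a'‖⁻¹ • (a + a')) (‖a - a'‖⁻¹ • (a - a'))
    (by rw [norm_smul, norm_inv, norm_norm, inv_mul_cancel₀ hP.ne'])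
    (by rw [norm_smul, norm_inv, norm_norm, inv_mul_cancel₀ hD.ne'])
    (by
      rw [real_inner_smul_left, real_inner_smul_right, real_inner_add_sub_eq_zero_iff a a' |>.2 (by rw [ha, ha'])]
      simp)
  set ρ : ℝ := ‖a - a'‖ / ‖a + a'‖ with hρ
  have hρ0 : 0 < ρ := by positivity
  obtain ⟨hcK, hconv, -, h0⟩ := id hK
  have hne : K.Nonempty := ⟨0, h0⟩
  obtain ⟨B, hB0, hB⟩ := exists_bound hcK
  set v : (Fin m → ℝ) → ℝ := fun y => suppFn K (uu b y) with hv
  have hv0 : ∀ y, 0 ≤ v y := fun y => suppFn_nonneg hcK h0 _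
  have hline : ∀ t : ℝ, |t| ≤ ρ → v (Pi.single j t) = 0 := by
    intro t ht
    have e : uu b (Pi.single j t) = (‖a + a'‖⁻¹ + t * ‖a - a'‖⁻¹) • a + (‖a + a'‖⁻¹ - t * ‖a - a'‖⁻¹) • a' := by
      have : ∑ i, (Pi.single j t : Fin m → ℝ) i • b i.succ = t • b j.succ := by
        rw [Finset.sum_eq_single j]
        · simp
        · intro i _ hi; simp [hi]
        · simp
      rw [uu, this, hb0, hb1]
      module
    have h1 : |t * ‖a - a'‖⁻¹| ≤ ‖a + a'‖⁻¹ := by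
      rw [abs_mul, abs_of_pos (inv_pos.2 hD)]
      calc |t| * ‖a - a'‖⁻¹ ≤ ρ * ‖a - a'‖⁻¹ := by gcongr
        _ = _ := by rw [hρ]; field_simp
    have h2 := abs_le.1 h1
    simp only [hv]
    rw [e]
    exact hz _ _ (by linarith) (by linarith)
  have hvb : ∀ ε : ℝ, 0 ≤ ε → ∀ y : Fin m → ℝ, |y j| ≤ ρ → (∀ k, k ≠ j → |y k| ≤ ε) → v y ≤ B * m * ε := by
    intro ε hε y h1 h2
    have h3 := suppFn_add_le hcK hne (uu b (Pi.single j (y j))) (uu b y - uu b (Pi.single j (y j)))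
    rw [add_sub_cancel] at h3
    have h4 := suppFn_le_norm hne hB (uu b y - uu b (Pi.single j (y j)))
    have h5 := uu_sub b y (Pi.single j (y j))
    have h6 : ‖y - Pi.single j (y j)‖ ≤ ε := by
      rw [pi_norm_le_iff_of_nonneg hε]
      intro k
      by_cases hk : k = j
      · subst hk; simpa using hε
      · simpa [hk] using h2 k hk
    have h7 := hline _ h1
    simp only [hv] at h7 ⊢
    rw [h7] at h3
    calc suppFn K (uu b y) ≤ B * ‖uu b y - uu b (Pi.single j (y j))‖ := by linarith
      _ ≤ B * (m * ε) := by
          gcongr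
          exact h5.trans (by gcongr)
      _ = _ := by ring
  obtain ⟨c, hc, hlow⟩ := lower_bd b hm hp hτ1 hf hK hsol (R := ρ + 1) (by positivity)
  have main : ∀ ε : ℝ, 0 < ε → ε ≤ 1 → c * (B * m * ε) ^ (p - 1) * (2 * (ρ / 2) * (2 * ε) ^ (m - 1)) ≤
      2 * (B * m * ε * (2 / ρ)) * (2 * B) ^ (m - 1) := by
    intro ε hε hε1
    set Q : Set (Fin m → ℝ) := Icc (fun k : Fin m => if k = j then -(ρ / 2) else -ε)
      (fun k => if k = j then ρ / 2 else ε) with hQ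
    have hQj : ∀ y ∈ Q, |y j| ≤ ρ / 2 := fun y hy =>
      abs_le.2 ⟨by simpa using hy.1 j, by simpa using hy.2 j⟩
    have hQk : ∀ y ∈ Q, ∀ k, k ≠ j → |y k| ≤ ε := fun y hy k hk =>
      abs_le.2 ⟨by simpa [hk] using hy.1 k, by simpa [hk] using hy.2 k⟩
    have h1 := hlow Q isCompact_Icc (by
      intro y hy
      rw [mem_closedBall_zero_iff, pi_norm_le_iff_of_nonneg (by positivity)]
      intro k
      rw [Real.norm_eq_abs]
      by_cases hk : k = j
      · subst hk; have := hQj y hy; linarith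
      · have := hQk y hy k hk; linarith) (B * m * ε) (by positivity)
      (fun y hy => hvb ε hε.le y (by have := hQj y hy; linarith) (hQk y hy))
    have h2 : sdI v Q ⊆ Icc (fun k : Fin m => if k = j then -(B * m * ε * (2 / ρ)) else -B)
        (fun k => if k = j then B * m * ε * (2 / ρ) else B) := by
      intro q hq
      have hqB : ‖q‖ ≤ B := by
        rw [hv, ← pp_faces b hcK hconv hne] at hq
        obtain ⟨z, hz', rfl⟩ := hq
        simp only [mem_iUnion, exists_prop] at hz'
        obtain ⟨y, -, hz'⟩ := hz'
        exact (pp_le b z).trans (hB z hz'.1)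
      simp only [sdI, mem_iUnion, exists_prop] at hq
      obtain ⟨y, hy, hq⟩ := hq
      have hs : ∀ s : ℝ, |s| ≤ 1 → s * q j ≤ B * m * ε * (2 / ρ) := by
        intro s hs
        have h3 := hq (y + Pi.single j (s * (ρ / 2)))
        have h4 : v (y + Pi.single j (s * (ρ / 2))) ≤ B * m * ε := by
          apply hvb ε hε.le
          · have := hQj y hy
            simp only [Pi.add_apply, Pi.single_eq_same]
            calc |y j + s * (ρ / 2)| ≤ |y j| + |s * (ρ / 2)| := abs_add_le _ _
              _ ≤ ρ / 2 + 1 * (ρ / 2) := by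
                  rw [abs_mul, abs_of_pos (by positivity : 0 < ρ / 2)]
                  gcongr
              _ = ρ := by ring
          · intro k hk
            simpa [hk] using hQk y hy k hk
        rw [add_sub_cancel_left, dotProduct_single] at h3
        have h5 := hv0 y
        have h6 : q j * (s * (ρ / 2)) ≤ B * m * ε := by linarith
        calc s * q j = q j * (s * (ρ / 2)) * (2 / ρ) := by field_simp
          _ ≤ _ := by gcongr
      have p1 := hs 1 (by simp)
      have p2 := hs (-1) (by simp)
      constructor <;> intro k
      · by_cases hk : k = j
        · subst hk; simp only [if_true]; linarith
        · simp only [hk, if_false]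
          have := (abs_le.1 ((norm_le_pi_norm q k).trans hqB)).1
          exact this
      · by_cases hk : k = j
        · subst hk; simp only [if_true]; linarith
        · simp only [hk, if_false]
          have := (abs_le.1 ((norm_le_pi_norm q k).trans hqB)).2
          exact this
    have h3 := h1.trans (measure_mono h2)
    rw [box_vol j (by positivity) hB0.le, hQ, box_vol j (by positivity) hε.le,
      ← ENNReal.ofReal_mul (by positivity)] at h3
    exact (ENNReal.ofReal_le_ofReal_iff (by positivity)).1 h3
  have hBm : 0 < B * m := by positivity
  have hBp : 0 < (B * m) ^ (p - 1) := Real.rpow_pos_of_pos hBm _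
  refine rpow_contra (e := p + m - 3)
    (C := (2 * (B * m * (2 / ρ)) * (2 * B) ^ (m - 1)) / (c * (B * m) ^ (p - 1) * ρ * 2 ^ (m - 1)))
    (by linarith) (by positivity) fun ε hε hε1 => ?_
  have h1 := main ε hε hε1
  rw [Real.mul_rpow hBm.le hε.le, mul_pow 2 ε] at h1
  have h2 : ε ^ (p + m - 3) = ε ^ (p - 1) * ε ^ (m - 1) / ε := by
    have : p + m - 3 = (p - 1) + ((m - 1 : ℕ) : ℝ) - 1 := by
      rw [Nat.cast_sub hm]; push_cast; ring
    rw [this, Real.rpow_sub hε, Real.rpow_add hε, Real.rpow_natCast, Real.rpow_one]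
  rw [h2, div_le_div_iff₀ hε (by positivity)]
  calc ε ^ (p - 1) * ε ^ (m - 1) * (c * (B * m) ^ (p - 1) * ρ * 2 ^ (m - 1))
      = c * ((B * m) ^ (p - 1) * ε ^ (p - 1)) * (2 * (ρ / 2) * (2 ^ (m - 1) * ε ^ (m - 1))) := by ring
    _ ≤ _ := h1
    _ = _ := by ring

lemma pick_normal {n : ℕ} {K : Set (EuclideanSpace ℝ (Fin n))} (hK : IsConvexBody0 K)
    {x us : EuclideanSpace ℝ (Fin n)} (hx : x ∈ K) (hus : us ∈ normalCone K x) (hpos : 0 < ⟪us, x⟫) :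
    ∃ u0 ∈ normalCone K x, ∃ lam : EuclideanSpace ℝ (Fin n), 0 < ⟪u0, x⟫ ∧ ⟪u0, lam⟫ = 0 ∧
      ∀ u ∈ normalCone K x, u ∉ Submodule.span ℝ {u0} → ⟪u, lam⟫ < 0 := by
  obtain ⟨hcK, hconv, ⟨k0, hk0⟩, h0⟩ := hK
  obtain ⟨r, hr, hball⟩ := Metric.nhds_basis_closedBall.mem_iff.1 (mem_interior_iff_mem_nhds.1 hk0)
  set e := x - k0 with he
  have hke : ∀ u ∈ normalCone K x, r * ‖u‖ ≤ ⟪u, e⟫ := by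
    intro u hu
    rcases eq_or_ne u 0 with rfl | hu0
    · simp
    have hn : 0 < ‖u‖ := norm_pos_iff.2 hu0
    have h1 : k0 + (r / ‖u‖) • u ∈ K := by
      apply hball
      rw [Metric.mem_closedBall, dist_eq_norm, add_sub_cancel_left, norm_smul, Real.norm_eq_abs,
        abs_of_pos (by positivity), div_mul_cancel₀ _ hn.ne']
    have h2 := hu _ h1
    rw [inner_add_right, real_inner_smul_right, real_inner_self_eq_norm_sq] at h2
    have h3 : r / ‖u‖ * ‖u‖ ^ 2 = r * ‖u‖ := by field_simp
    rw [h3] at h2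
    rw [he, inner_sub_right]
    linarith
  set C : Set (EuclideanSpace ℝ (Fin n)) := normalCone K x ∩ {u | ⟪u, e⟫ = 1} with hC
  have hsm : ∀ u ∈ normalCone K x, ∀ t : ℝ, 0 ≤ t → t • u ∈ normalCone K x := by
    intro u hu t ht y hy
    rw [real_inner_smul_left, real_inner_smul_left]
    exact mul_le_mul_of_nonneg_left (hu y hy) ht
  have hNcl : IsClosed (normalCone K x) := by
    have : normalCone K x = ⋂ y ∈ K, {u | ⟪u, y⟫ ≤ ⟪u, x⟫} := by
      ext u; simp [normalCone]
    rw [this]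
    exact isClosed_biInter fun y _ => isClosed_le (by fun_prop) (by fun_prop)
  have hCn : ∀ u ∈ C, ‖u‖ ≤ 1 / r := by
    intro u hu
    have := hke u hu.1
    rw [show ⟪u, e⟫ = 1 from hu.2] at this
    rw [le_div_iff₀ hr]; linarith
  have hCc : IsCompact C := by
    refine Metric.isCompact_of_isClosed_isBounded
      (hNcl.inter (isClosed_eq (by fun_prop) (by fun_prop))) ?_
    exact isBounded_iff_forall_norm_le.2 ⟨1 / r, hCn⟩
  have hCof : ∀ u ∈ normalCone K x, u ≠ 0 → 0 < ⟪u, e⟫ ∧ (⟪u, e⟫)⁻¹ • u ∈ C := by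
    intro u hu hu0
    have h1 : 0 < ⟪u, e⟫ := lt_of_lt_of_le (mul_pos hr (norm_pos_iff.2 hu0)) (hke u hu)
    refine ⟨h1, hsm u hu _ (by positivity), ?_⟩
    show ⟪(⟪u, e⟫)⁻¹ • u, e⟫ = 1
    rw [real_inner_smul_left]; field_simp
  have hus0 : us ≠ 0 := by rintro rfl; simp at hpos
  obtain ⟨hk, hcC⟩ := hCof us hus hus0
  set cs := (⟪us, e⟫)⁻¹ • us with hcs
  have hcx : 0 < ⟪cs, x⟫ := by rw [hcs, real_inner_smul_left]; positivity
  set Λ := (1 / r ^ 2) / ⟪cs, x⟫ with hΛ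
  have hΛ0 : 0 < Λ := by positivity
  obtain ⟨u0, hu0, hmax⟩ := hCc.exists_isMaxOn ⟨cs, hcC⟩
    (f := fun u => ‖u‖ ^ 2 + 2 * Λ * ⟪u, x⟫) (by fun_prop)
  have hmax' : ∀ c ∈ C, ‖c‖ ^ 2 + 2 * Λ * ⟪c, x⟫ ≤ ‖u0‖ ^ 2 + 2 * Λ * ⟪u0, x⟫ := fun c hc => hmax hc
  have hu0e : ⟪u0, e⟫ = 1 := hu0.2
  refine ⟨u0, hu0.1, u0 + Λ • x - ⟪u0 + Λ • x, u0⟫ • e, ?_, ?_, ?_⟩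
  · by_contra hneg
    push Not at hneg
    have h1 := hmax' cs hcC
    have h2 : Λ * ⟪cs, x⟫ = 1 / r ^ 2 := by rw [hΛ]; field_simp
    have h3 : ‖u0‖ ^ 2 ≤ 1 / r ^ 2 := by
      have := hCn u0 hu0
      calc ‖u0‖ ^ 2 ≤ (1 / r) ^ 2 := by gcongr
        _ = _ := by ring
    have h4 : Λ * ⟪u0, x⟫ ≤ 0 := mul_nonpos_of_nonneg_of_nonpos hΛ0.le hneg
    have h5 : 0 < 1 / r ^ 2 := by positivity
    nlinarith [sq_nonneg ‖cs‖]
  · rw [inner_sub_right, real_inner_smul_right, hu0e, real_inner_comm u0]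
    ring
  · intro u hu hus
    have hune : u ≠ 0 := by rintro rfl; exact hus (Submodule.zero_mem _)
    obtain ⟨h1, h2⟩ := hCof u hu hune
    set k := ⟪u, e⟫ with hkd
    have hne : k⁻¹ • u ≠ u0 := by
      intro h
      apply hus
      rw [Submodule.mem_span_singleton]
      exact ⟨k, by rw [← h, smul_smul, mul_inv_cancel₀ h1.ne', one_smul]⟩
    set c := k⁻¹ • u with hcd
    have hu : u = k • c := by rw [hcd, smul_smul, mul_inv_cancel₀ h1.ne', one_smul]
    clear_value c
    have h3 := hmax' c h2
    have h4 : 0 < ‖c - u0‖ ^ 2 := by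
      have := norm_pos_iff.2 (sub_ne_zero.2 hne); positivity
    rw [norm_sub_sq_real] at h4
    have hce : ⟪c, e⟫ = 1 := h2.2
    have h5 : ⟪c, u0 + Λ • x - ⟪u0 + Λ • x, u0⟫ • e⟫ < 0 := by
      rw [inner_sub_right, real_inner_smul_right, hce, inner_add_right, real_inner_smul_right,
        inner_add_left, real_inner_smul_left, real_inner_self_eq_norm_sq, real_inner_comm u0 x]
      linarith
    rw [hu, real_inner_smul_left]
    exact mul_neg_of_pos_of_neg h1 h5

lemma partB {m : ℕ} (hm : 0 < m) {K : Set (EuclideanSpace ℝ (Fin (m+1)))} {p τ1 τ2 : ℝ} (hp : p < 1)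
    (hτ1 : 0 < τ1) (hτ2 : 0 < τ2)
    {f : EuclideanSpace ℝ (Fin (m+1)) → ℝ} (hf : ∀ u ∈ unitSphere (m+1), τ1 < f u)
    (hf2 : ∀ u ∈ unitSphere (m+1), f u < τ2)
    (hK : IsConvexBody0 K) (hsol : IsLpSolution p f K) {x us : EuclideanSpace ℝ (Fin (m+1))}
    (hx : x ∈ K) (hus : us ∈ normalCone K x) (hpos : 0 < ⟪us, x⟫)
    (hN2 : ∀ u, ∃ w ∈ normalCone K x, w ∉ Submodule.span ℝ {u}) : False := by
  obtain ⟨u0, hu0, lam, hu0x, hu0l, hlam⟩ := pick_normal hK hx hus hpos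
  have hK' := hK
  obtain ⟨hcK, hconv, -, h0⟩ := hK'
  have hne : K.Nonempty := ⟨0, h0⟩
  have hu00 : u0 ≠ 0 := by rintro rfl; simp at hu0x
  have hn0 : 0 < ‖u0‖ := norm_pos_iff.2 hu00
  obtain ⟨b, hb⟩ := exists_basis1 (‖u0‖⁻¹ • u0) (by
    rw [norm_smul, norm_inv, norm_norm, inv_mul_cancel₀ hn0.ne'])
  have hsm : ∀ u ∈ normalCone K x, ∀ t : ℝ, 0 ≤ t → t • u ∈ normalCone K x := by
    intro u hu t ht y hy
    rw [real_inner_smul_left, real_inner_smul_left]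
    exact mul_le_mul_of_nonneg_left (hu y hy) ht
  have hadd : ∀ u ∈ normalCone K x, ∀ w ∈ normalCone K x, u + w ∈ normalCone K x := by
    intro u hu w hw y hy
    rw [inner_add_left, inner_add_left]
    exact add_le_add (hu y hy) (hw y hy)
  have hb0 : b 0 ∈ normalCone K x := by rw [hb]; exact hsm _ hu0 _ (by positivity)
  have hb0x : 0 < ⟪b 0, x⟫ := by rw [hb, real_inner_smul_left]; positivity
  have hb0l : ⟪b 0, lam⟫ = 0 := by rw [hb, real_inner_smul_left, hu0l, mul_zero]
  have hspan : ∀ w, w ∈ Submodule.span ℝ {u0} → ∃ c : ℝ, w = c • b 0 := by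
    intro w hw
    obtain ⟨c, rfl⟩ := Submodule.mem_span_singleton.1 hw
    exact ⟨c * ‖u0‖, by rw [hb, smul_smul, mul_assoc, mul_inv_cancel₀ hn0.ne', mul_one]⟩
  have hppb0 : pp b (b 0) = 0 := by
    ext i
    exact b.orthonormal.2 (Fin.succ_ne_zero i)
  have huu0 : uu b 0 = b 0 := by simp [uu]
  set h : (Fin m → ℝ) → ℝ := fun y => suppFn K (uu b y) with hh
  set V : (Fin m → ℝ) → ℝ := fun y => h y - (pp b x ⬝ᵥ y + ⟪b 0, x⟫) with hV
  have hVe : ∀ y, V y = suppFn K (uu b y) - ⟪uu b y, x⟫ := by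
    intro y
    simp only [hV, hh]
    rw [inner_uu, dotProduct_comm, add_comm ⟪b 0, x⟫]
  have hV0 : ∀ y, 0 ≤ V y := by
    intro y
    rw [hVe]
    linarith [le_suppFn hcK (uu b y) hx]
  have hVN : ∀ y, V y = 0 → uu b y ∈ normalCone K x := by
    intro y hy z hz
    rw [hVe] at hy
    linarith [le_suppFn hcK (uu b y) hz]
  have hNV : ∀ y, uu b y ∈ normalCone K x → V y = 0 := by
    intro y hy
    refine le_antisymm ?_ (hV0 y)
    rw [hVe]
    linarith [suppFn_le hne (uu b y) hy]
  have hhcont : Continuous h := (suppFn_continuous hcK hne).comp (uu_continuous b)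
  have hVcont : Continuous V := by
    simp only [hV]
    refine hhcont.sub ?_
    unfold dotProduct
    fun_prop
  have hVconv : ConvexOn ℝ univ V := by
    refine ⟨convex_univ, fun y _ y' _ s t hs ht hst => ?_⟩
    rw [hVe, hVe, hVe]
    have e1 : uu b (s • y + t • y') = s • uu b y + t • uu b y' := by
      have hst' : b 0 = s • b 0 + t • b 0 := by rw [← add_smul, hst, one_smul]
      simp only [uu, Pi.add_apply, Pi.smul_apply, smul_eq_mul, add_smul, Finset.sum_add_distrib,
        smul_add, Finset.smul_sum, smul_smul]
      nth_rw 1 [hst']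
      abel
    have e2 : suppFn K (s • uu b y + t • uu b y') ≤ s * suppFn K (uu b y) + t * suppFn K (uu b y') := by
      refine suppFn_le hne _ fun z hz => ?_
      rw [inner_add_left, real_inner_smul_left, real_inner_smul_left]
      gcongr
      · exact le_suppFn hcK _ hz
      · exact le_suppFn hcK _ hz
    rw [e1, inner_add_left, real_inner_smul_left, real_inner_smul_left, smul_eq_mul, smul_eq_mul]
    linarith
  have hs : 0 < ⟪b 0, x⟫ / 2 := by positivity
  have hev : ∀ᶠ y in nhds (0 : Fin m → ℝ), ⟪b 0, x⟫ / 2 < h y := by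
    refine hhcont.continuousAt.eventually_const_lt ?_
    simp only [hh, huu0]
    linarith [le_suppFn hcK (b 0) hx]
  obtain ⟨R, hR, hRs⟩ := Metric.nhds_basis_closedBall.mem_iff.1 hev
  obtain ⟨B, hB0, hB⟩ := exists_bound hcK
  obtain ⟨c, hc, hlow⟩ := lower_bd b hm hp hτ1 hf hK hsol hR.le
  obtain ⟨c2, hc2, hup⟩ := upper_bd b hm hp hτ2 hf2 hK hsol hR.le hs
  set t := B * (1 + m * R) with ht
  have ht0 : 0 < t := by positivity
  obtain ⟨w, hwN, hw⟩ := hN2 u0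
  set w' := b 0 + (1 / (|⟪b 0, w⟫| + 1)) • w with hw'
  have hw'N : w' ∈ normalCone K x := hadd _ hb0 _ (hsm _ hwN _ (by positivity))
  have hd : 0 < ⟪b 0, w'⟫ := by
    rw [hw', inner_add_right, real_inner_smul_right, real_inner_self_eq_norm_sq, b.orthonormal.1 0]
    have h1 : -1 < 1 / (|⟪b 0, w⟫| + 1) * ⟪b 0, w⟫ := by
      rw [div_mul_eq_mul_div, one_mul, lt_div_iff₀ (by positivity)]
      linarith [neg_abs_le ⟪b 0, w⟫]
    linarith
  set d := ⟪b 0, w'⟫ with hdd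
  have huy1 : uu b (pp b (d⁻¹ • w')) = d⁻¹ • w' := by
    have := uu_decomp b (d⁻¹ • w')
    rw [real_inner_smul_right, ← hdd, inv_mul_cancel₀ hd.ne', one_smul] at this
    exact this.symm
  refine core_thm hm hVconv hVcont hV0 (hNV 0 (by rwa [huu0])) hR
    (c1 := c * t ^ (p - 1)) (c2 := c2) (by positivity) hc2 ?_ ?_ (pp b lam) ?_
    (pp b (d⁻¹ • w')) ?_ ?_
  · intro ω hω hωR
    rw [hV, sdI_shift]
    refine hlow ω hω hωR t ht0 fun y hy => ?_
    refine (suppFn_le_norm hne hB _).trans ?_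
    have h1 := norm_uu_le b y
    have h2 : ‖y‖ ≤ R := by simpa using hωR hy
    rw [ht]
    gcongr
    refine h1.trans ?_
    gcongr
  · intro ω hω hωR
    rw [hV, sdI_shift]
    exact hup ω hω hωR fun y hy => (hRs (hωR hy)).le
  · intro y hy hy0
    have h1 := hlam _ (hVN y hy) (by
      intro hmem
      obtain ⟨c, hc⟩ := hspan _ hmem
      apply hy0
      rw [← pp_uu b y, hc, pp_smul, hppb0, smul_zero])
    rw [inner_uu, hb0l, zero_add] at h1
    rwa [dotProduct_comm]
  · apply hNV
    rw [huy1]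
    exact hsm _ hw'N _ (by positivity)
  · intro h1
    rw [h1, huu0] at huy1
    apply hw
    have h2 : w' = d • b 0 := by rw [huy1, smul_smul, mul_inv_cancel₀ hd.ne', one_smul]
    have hmem : b 0 ∈ Submodule.span ℝ {u0} := by
      rw [hb]; exact Submodule.smul_mem _ _ (Submodule.mem_span_singleton_self _)
    have h3 : (1 / (|⟪b 0, w⟫| + 1)) • w = (d - 1) • b 0 := by
      rw [sub_smul, ← h2, one_smul, hw', add_sub_cancel_left]
    have h4 : w = ((|⟪b 0, w⟫| + 1) * (d - 1)) • b 0 := by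
      rw [mul_smul, ← h3, smul_smul, mul_one_div_cancel (by positivity), one_smul]
    rw [h4]
    exact Submodule.smul_mem _ _ hmem

/-- **Theorem 1.3 (i).** If `n = 2`, `n = 3`, or `n > 3` and `p < 4 - n`, then any
solution `K` of the `L_p` Minkowski problem is smooth. -/
theorem stmt3 {n : ℕ} (hn : 2 ≤ n) {p : ℝ} (hp : p < 1) {τ1 τ2 : ℝ}
    (hτ1 : 0 < τ1) (hτ12 : τ1 < τ2) {f : EuclideanSpace ℝ (Fin n) → ℝ}
    (hf : ∀ u ∈ unitSphere n, τ1 < f u ∧ f u < τ2)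
    {K : Set (EuclideanSpace ℝ (Fin n))} (hK : IsConvexBody0 K)
    (hsol : IsLpSolution p f K)
    (hcase : n = 2 ∨ n = 3 ∨ (3 < n ∧ p < 4 - (n : ℝ))) :
    IsSmoothBody K := by
  obtain ⟨m, rfl⟩ : ∃ m, n = m + 1 := ⟨n - 1, by omega⟩
  have hm : 0 < m := by omega
  have hpm : p + m < 3 := by
    rcases hcase with h | h | ⟨h, h'⟩
    · have : m = 1 := by omega
      subst this; push_cast; linarith
    · have : m = 2 := by omega
      subst this; push_cast; linarith
    · push_cast at h'; linarith
  have hK' := hK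
  obtain ⟨hcK, hconv, hint, h0⟩ := hK'
  have hne : K.Nonempty := ⟨0, h0⟩
  intro x hxf
  have hx : x ∈ K := hcK.isClosed.frontier_subset hxf
  have hxi : x ∉ interior K := hxf.2
  obtain ⟨v, hvN, hv0⟩ : ∃ v ∈ normalCone K x, v ≠ 0 := by
    obtain ⟨g, hg⟩ := geometric_hahn_banach_open_point hconv.interior isOpen_interior hxi
    refine ⟨(InnerProductSpace.toDual ℝ _).symm g, ?_, ?_⟩
    · intro y hy
      rw [InnerProductSpace.toDual_symm_apply, InnerProductSpace.toDual_symm_apply]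
      have hy' : y ∈ closure (interior K) := by
        rw [hconv.closure_interior_eq_closure_of_nonempty_interior hint]
        exact subset_closure hy
      exact le_on_closure (fun z hz => (hg z hz).le) g.continuous.continuousOn continuousOn_const hy'
    · intro h
      obtain ⟨k, hk⟩ := hint
      have h1 := hg k hk
      have h2 : g = 0 := by simpa using h
      rw [h2] at h1
      simp at h1
  by_contra hns
  have hN2 : ∀ u, ∃ w ∈ normalCone K x, w ∉ Submodule.span ℝ {u} := by
    by_contra hcon
    push Not at hcon
    obtain ⟨u, hu⟩ := hcon
    apply hns
    have hsp : Submodule.span ℝ (normalCone K x) = Submodule.span ℝ {v} := by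
      apply le_antisymm
      · rw [Submodule.span_le]
        intro w hw
        obtain ⟨c, hc⟩ := Submodule.mem_span_singleton.1 (hu w hw)
        obtain ⟨c', hc'⟩ := Submodule.mem_span_singleton.1 (hu v hvN)
        have hc0 : c' ≠ 0 := by rintro rfl; apply hv0; rw [← hc', zero_smul]
        refine Submodule.mem_span_singleton.2 ⟨c * c'⁻¹, ?_⟩
        rw [← hc', smul_smul, mul_assoc, inv_mul_cancel₀ hc0, mul_one, hc]
      · exact Submodule.span_mono (by simpa using hvN)
    unfold IsSmoothPt
    rw [hsp]
    exact finrank_span_singleton hv0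
  by_cases hpos : ∃ u ∈ normalCone K x, 0 < ⟪u, x⟫
  · obtain ⟨us, hus, hp'⟩ := hpos
    exact partB hm hp hτ1 (hτ1.trans hτ12) (fun u hu => (hf u hu).1) (fun u hu => (hf u hu).2)
      hK hsol hx hus hp' hN2
  · push Not at hpos
    obtain ⟨w1, hw1N, hw1⟩ := hN2 0
    obtain ⟨w2, hw2N, hw2⟩ := hN2 w1
    have hw10 : w1 ≠ 0 := by rintro rfl; exact hw1 (Submodule.zero_mem _)
    have hw20 : w2 ≠ 0 := by rintro rfl; exact hw2 (Submodule.zero_mem _)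
    have hn1 : 0 < ‖w1‖ := norm_pos_iff.2 hw10
    have hn2 : 0 < ‖w2‖ := norm_pos_iff.2 hw20
    refine partA hm hp hpm hτ1 (fun u hu => (hf u hu).1) hK hsol (‖w1‖⁻¹ • w1) (‖w2‖⁻¹ • w2)
      ?_ ?_ ?_ ?_ ?_
    · rw [norm_smul, norm_inv, norm_norm, inv_mul_cancel₀ hn1.ne']
    · rw [norm_smul, norm_inv, norm_norm, inv_mul_cancel₀ hn2.ne']
    · intro h
      apply hw2
      refine Submodule.mem_span_singleton.2 ⟨‖w2‖ * ‖w1‖⁻¹, ?_⟩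
      rw [mul_smul, h, smul_smul, mul_inv_cancel₀ hn2.ne', one_smul]
    · intro h
      apply hw2
      refine Submodule.mem_span_singleton.2 ⟨-(‖w2‖ * ‖w1‖⁻¹), ?_⟩
      rw [neg_smul, mul_smul, h, smul_neg, neg_neg, smul_smul, mul_inv_cancel₀ hn2.ne', one_smul]
    · intro s t hs ht
      have hN : s • (‖w1‖⁻¹ • w1) + t • (‖w2‖⁻¹ • w2) ∈ normalCone K x := by
        intro y hy
        simp only [inner_add_left, real_inner_smul_left]
        have := hw1N y hy
        have := hw2N y hy
        gcongr
      refine le_antisymm ?_ (suppFn_nonneg hcK h0 _)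
      exact (suppFn_le hne _ hN).trans (hpos _ hN)
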